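/- arXiv:2411.01247 — 2 statements merged into one kernel-verified Lean document; each statement's English description precedes it below -/
import Mathlib

section
/- Fix an integer d ≥ 2 and let 𝕏_d(H) denote either 𝔸_d(H) or 𝔸'_d(H); for a set J ⊂ [0,1] write #(J ∩ 𝕏_d(H)) for the number of α ∈ 𝕏_d(H) whose reduction modulo 1 lies in J. There exist constants H₀(d) ≥ 2 and C(d), C'(d), C₁(𝕏_d), C₂(𝕏_d) > 0 such that, setting E(H) = C(d)·√((log H)^{l(d)}/H) when 𝕏_d = 𝔸_d and E(H) = C'(d)·(log H)^{l(d)}/H when 𝕏_d = 𝔸'_d, the following holds for every approximation function Ψ, all integers Q₂ > Q₁ ≥ 1, every δ ∈ (0,1) and every integer H ≥ H₀(d): if Θ_Ψ(Q₁,Q₂) := min_{Q₁ ≤ q < Q₂} 2Ψ(q)/q < C₁(𝕏_d)·δ, then #(J_Ψ(Q₁,Q₂) ∩ 𝕏_d(H))/#𝕏_d(H) ≤ C₂(𝕏_d)·|J_Ψ(Q₁,Q₂)|·(1 + Θ_Ψ(Q₁,Q₂))·(1/(1−δ) + E(H)/Θ_Ψ(Q₁,Q₂)), where |·| denotes Lebesgue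 measure. -/
open MeasureTheory Set

noncomputable section

/-- `l(d) = 1` if `d = 2` and `0` otherwise. -/
def lfun (d : ℕ) : ℕ := if d = 2 then 1 else 0

/-- The set of real algebraic numbers of degree `d` whose naive height (max absolute value of
the coefficients of the minimal polynomial with coprime integer coefficients) is at most `H`. -/
def algSet (d : ℕ) (H : ℝ) : Set ℝ :=
  {α : ℝ | ∃ P : Polynomial ℤ, Irreducible P ∧ P.natDegree = d ∧
    (∀ k, |(P.coeff k : ℝ)| ≤ H) ∧ Polynomial.aeval α P = 0}

/-- `𝕏_d(H)`: either `𝔸_d(H)` (prime = false) or `𝔸'_d(H) = 𝔸_d(H) ∩ [0,1]` (prime = true). -/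
def XSet (d : ℕ) (H : ℝ) (prime : Bool) : Set ℝ :=
  if prime then algSet d H ∩ Set.Icc 0 1 else algSet d H

/-- An approximation function: positive, nonincreasing on `(0,∞)`, tending to zero at infinity. -/
def IsApproxFun (Ψ : ℝ → ℝ) : Prop :=
  (∀ x : ℝ, 0 < x → 0 < Ψ x) ∧ AntitoneOn Ψ (Set.Ioi 0) ∧
    Filter.Tendsto Ψ Filter.atTop (nhds 0)

/-- The set `J_Ψ(Q₁,Q₂)`. -/
def JPsi (Ψ : ℝ → ℝ) (Q₁ Q₂ : ℕ) : Set ℝ :=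
  ⋃ q ∈ Finset.Ico Q₁ Q₂, ⋃ p ∈ Finset.range (q + 1),
    Set.Icc ((p : ℝ) / q - Ψ q / q) ((p : ℝ) / q + Ψ q / q) ∩ Set.Icc 0 1

/-- `Θ_Ψ(Q₁,Q₂) = min_{Q₁ ≤ q < Q₂} 2 Ψ(q)/q`. -/
def Theta (Ψ : ℝ → ℝ) (Q₁ Q₂ : ℕ) : ℝ :=
  sInf ((fun q : ℕ => 2 * Ψ q / q) '' {q : ℕ | Q₁ ≤ q ∧ q < Q₂})

/-- Number of elements of `Xs` whose reduction modulo one lies in `J`. -/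
def countModOne (Xs : Set ℝ) (J : Set ℝ) : ℕ :=
  Set.ncard {α : ℝ | α ∈ Xs ∧ Int.fract α ∈ J}

/-- The error term `E(H)`: for `𝔸'_d` (prime) it is `C (log H)^{l(d)}/H`, for `𝔸_d` it is
`C √((log H)^{l(d)}/H)`. -/
def ErrTerm (prime : Bool) (C : ℝ) (d : ℕ) (H : ℕ) : ℝ :=
  if prime then C * Real.log H ^ lfun d / H
  else C * Real.sqrt (Real.log H ^ lfun d / H)


namespace AlgCount

open Polynomial

open Classical in
/-- Integer coefficient vectors of height at most `H` whose polynomial has a root in `S`. -/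
def VSet (d H : ℕ) (S : Set ℝ) : Finset (Fin (d + 1) → ℤ) :=
  (Fintype.piFinset fun _ => Finset.Icc (-(H : ℤ)) H).filter
    (fun a => ∃ x ∈ S, ∑ i, (a i : ℝ) * x ^ (i : ℕ) = 0)

lemma mem_VSet {d H : ℕ} {S : Set ℝ} {a : Fin (d + 1) → ℤ} :
    a ∈ VSet d H S ↔ (∀ i, -(H : ℤ) ≤ a i ∧ a i ≤ H) ∧
      ∃ x ∈ S, ∑ i, (a i : ℝ) * x ^ (i : ℕ) = 0 := by
  simp [VSet, Fintype.mem_piFinset]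

lemma pow_sub_le (x y : ℝ) (hx : |x| ≤ 1) (hy : |y| ≤ 1) (n : ℕ) :
    |x ^ n - y ^ n| ≤ n * |x - y| := by
  induction n with
  | zero => simp
  | succ k ih =>
    have e : x ^ (k + 1) - y ^ (k + 1) = x * (x ^ k - y ^ k) + (x - y) * y ^ k := by ring
    rw [e]
    have h1 : |x * (x ^ k - y ^ k)| ≤ k * |x - y| := by
      rw [abs_mul]
      calc |x| * |x ^ k - y ^ k| ≤ 1 * |x ^ k - y ^ k| := by gcongr
        _ ≤ _ := by linarith
    have h2 : |(x - y) * y ^ k| ≤ |x - y| := by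
      rw [abs_mul, abs_pow]
      exact mul_le_of_le_one_right (abs_nonneg _) (pow_le_one₀ (abs_nonneg _) hy)
    calc _ ≤ _ := abs_add_le _ _
      _ ≤ k * |x - y| + |x - y| := add_le_add h1 h2
      _ = _ := by push_cast; ring

lemma eval_bound {d H : ℕ} {a : Fin (d + 1) → ℤ} (ha : ∀ i, -(H : ℤ) ≤ a i ∧ a i ≤ H)
    {u x w : ℝ} (hu : |u| ≤ 1) (hx : |x| ≤ 1) (hw : |u - x| ≤ w)
    (h0 : ∑ i, (a i : ℝ) * x ^ (i : ℕ) = 0) :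
    |∑ i, (a i : ℝ) * u ^ (i : ℕ)| ≤ (d + 1) * (H * (d * w)) := by
  have e : ∑ i, (a i : ℝ) * u ^ (i : ℕ) = ∑ i, (a i : ℝ) * (u ^ (i : ℕ) - x ^ (i : ℕ)) := by
    simp only [mul_sub, Finset.sum_sub_distrib, h0, sub_zero]
  rw [e]
  calc _ ≤ ∑ i : Fin (d + 1), |(a i : ℝ) * (u ^ (i : ℕ) - x ^ (i : ℕ))| :=
        Finset.abs_sum_le_sum_abs _ _
    _ ≤ ∑ i : Fin (d + 1), (H * (d * w) : ℝ) := by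
        apply Finset.sum_le_sum
        intro i _
        rw [abs_mul]
        have h1 : |(a i : ℝ)| ≤ H := by
          rw [abs_le]
          exact ⟨by exact_mod_cast (ha i).1, by exact_mod_cast (ha i).2⟩
        have h2 : |u ^ (i : ℕ) - x ^ (i : ℕ)| ≤ d * w := by
          refine (pow_sub_le u x hu hx i).trans ?_
          have : ((i : ℕ) : ℝ) ≤ d := by exact_mod_cast Nat.lt_succ_iff.1 i.2
          gcongr
        gcongr
    _ = _ := by simp

lemma VSet_card {d H : ℕ} {S : Set ℝ} {u v : ℝ} (hu : -1 ≤ u) (hv : v ≤ 1) (huv : u ≤ v)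
    (hS : S ⊆ Icc u v) :
    ((VSet d H S).card : ℝ) ≤
      (2 * (d + 1) * (H * (d * (v - u))) + 1) * (2 * H + 1) ^ d := by
  classical
  set r : ℝ := (d + 1) * (H * (d * (v - u))) with hr
  have hr0 : 0 ≤ r := by
    have : 0 ≤ v - u := by linarith
    positivity
  have key : (VSet d H S).card ≤ (⌊2 * r⌋₊ + 1) *
      (Fintype.piFinset fun _ : Fin d => Finset.Icc (-(H : ℤ)) H).card := by
    apply Finset.card_le_mul_card_image_of_maps_to (f := fun a => fun i : Fin d => a i.succ)
    · intro a ha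
      rw [mem_VSet] at ha
      simp only [Fintype.mem_piFinset, Finset.mem_Icc]
      exact fun i => ha.1 _
    · intro b _
      set m : ℝ := -∑ i : Fin d, (b i : ℝ) * u ^ ((i : ℕ) + 1) with hm
      have : (Finset.filter (fun a => (fun i : Fin d => a i.succ) = b) (VSet d H S)).card ≤
          (Finset.Icc ⌈m - r⌉ ⌊m + r⌋).card := by
        apply Finset.card_le_card_of_injOn (fun a => a 0)
        · intro a ha
          simp only [Finset.coe_filter, Set.mem_ofPred_eq] at ha
          obtain ⟨ha, hb⟩ := ha
          rw [mem_VSet] at ha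
          obtain ⟨ha, x, hx, h0⟩ := ha
          have hx' := hS hx
          have := eval_bound ha (u := u) (w := v - u) (abs_le.2 ⟨hu, by linarith⟩)
            (abs_le.2 ⟨by linarith [hx'.1], by linarith [hx'.2]⟩)
            (abs_le.2 ⟨by linarith [hx'.2], by linarith [hx'.1]⟩) h0
          rw [Fin.sum_univ_succ, ← hr] at this
          have e : ∑ i : Fin d, ((a i.succ : ℤ) : ℝ) * u ^ ((i.succ : Fin (d + 1)) : ℕ) = -m := by
            rw [hm, neg_neg, ← hb]
            simp
          rw [e] at this
          simp only [Fin.val_zero, pow_zero, mul_one] at this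
          rw [abs_le] at this
          simp only [Finset.coe_Icc, Set.mem_Icc, Int.ceil_le, Int.le_floor]
          exact ⟨by linarith, by linarith⟩
        · intro a ha a' ha' h
          simp only [Finset.coe_filter, Set.mem_ofPred_eq] at ha ha'
          funext i
          refine Fin.cases h (fun j => ?_) i
          have := ha.2.trans ha'.2.symm
          exact congrFun this j
      refine this.trans ?_
      rw [Int.card_Icc, Int.toNat_le]
      have h1 : (⌊m + r⌋ : ℝ) ≤ m + r := Int.floor_le _
      have h2 : m - r ≤ ⌈m - r⌉ := Int.le_ceil _
      have h3 : ⌊m + r⌋ - ⌈m - r⌉ ≤ ⌊2 * r⌋ := by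
        rw [Int.le_floor]; push_cast; linarith
      have h4 : (⌊2 * r⌋₊ : ℤ) = ⌊2 * r⌋ := Int.natCast_floor_eq_floor (by positivity)
      push_cast
      omega
  have hc : ((Fintype.piFinset fun _ : Fin d => Finset.Icc (-(H : ℤ)) H).card : ℝ)
      = (2 * H + 1) ^ d := by
    rw [Fintype.card_piFinset]
    simp only [Int.card_Icc, Finset.prod_const, Finset.card_univ, Fintype.card_fin]
    have : ((H : ℤ) + 1 - -(H : ℤ)).toNat = 2 * H + 1 := by omega
    rw [this]; push_cast; ring
  calc ((VSet d H S).card : ℝ) ≤ ((⌊2 * r⌋₊ + 1 : ℕ) : ℝ) *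
      ((Fintype.piFinset fun _ : Fin d => Finset.Icc (-(H : ℤ)) H).card : ℝ) := by
        exact_mod_cast key
    _ ≤ (2 * r + 1) * (2 * H + 1) ^ d := by
        rw [hc]
        have : (⌊2 * r⌋₊ : ℝ) ≤ 2 * r := Nat.floor_le (by positivity)
        push_cast
        gcongr
    _ = _ := by rw [hr]; ring

lemma VSet_inv {d H : ℕ} {S : Set ℝ} (h0 : ∀ x ∈ S, x ≠ 0) :
    (VSet d H S).card ≤ (VSet d H ((fun x => x⁻¹) '' S)).card := by
  apply Finset.card_le_card_of_injOn (fun a => a ∘ Fin.rev)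
  · intro a ha
    simp only [Finset.mem_coe] at ha ⊢
    rw [mem_VSet] at ha ⊢
    obtain ⟨ha, x, hx, hs⟩ := ha
    refine ⟨fun i => ha _, x⁻¹, ⟨x, hx, rfl⟩, ?_⟩
    have hx0 := h0 x hx
    rw [← Equiv.sum_comp Fin.revPerm]
    have : ∀ i : Fin (d + 1), (((a ∘ Fin.rev) (Fin.revPerm i) : ℤ) : ℝ) *
        x⁻¹ ^ ((Fin.revPerm i : Fin (d + 1)) : ℕ) = (x⁻¹) ^ d * ((a i : ℝ) * x ^ (i : ℕ)) := by
      intro i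
      simp only [Function.comp, Fin.revPerm_apply, Fin.rev_rev, Fin.val_rev]
      have hp : x⁻¹ ^ d = x⁻¹ ^ (d + 1 - ((i : ℕ) + 1)) * x⁻¹ ^ (i : ℕ) := by
        rw [← pow_add]; congr 1; omega
      rw [hp]
      have e : x⁻¹ ^ (i : ℕ) * x ^ (i : ℕ) = 1 := by
        rw [← mul_pow, inv_mul_cancel₀ hx0, one_pow]
      linear_combination (-(a i : ℝ) * x⁻¹ ^ (d + 1 - ((i : ℕ) + 1))) * e
    rw [Finset.sum_congr rfl (fun i _ => this i), ← Finset.mul_sum, hs, mul_zero]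
  · intro a _ b _ h
    funext i
    have := congrFun h (Fin.rev i)
    simpa using this

lemma alg_count {d H : ℕ} (S : Set ℝ) :
    (algSet d H ∩ S).Finite ∧ (algSet d H ∩ S).ncard ≤ (VSet d H S).card * d := by
  classical
  set pol : (Fin (d + 1) → ℤ) → ℝ[X] := fun a => ∑ i, C (a i : ℝ) * X ^ (i : ℕ) with hpol
  have hsub : algSet d H ∩ S ⊆
      (((VSet d H S).biUnion fun a => (pol a).roots.toFinset : Finset ℝ) : Set ℝ) := by
    rintro α ⟨⟨P, hirr, hdeg, hht, hα⟩, hS⟩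
    have hP : P.map (algebraMap ℤ ℝ) = pol (fun i => P.coeff i) := by
      rw [hpol, as_sum_range' P (d + 1) (by omega), Polynomial.map_sum, Finset.sum_range]
      apply Finset.sum_congr rfl
      intro i _
      rw [map_monomial, ← C_mul_X_pow_eq_monomial]
      congr 2
      have := as_sum_range' P (d + 1) (by omega)
      rw [← this]
      simp
    have hP0 : P.map (algebraMap ℤ ℝ) ≠ 0 := by
      rw [Ne, Polynomial.map_eq_zero_iff (RingHom.injective_int _)]
      exact hirr.ne_zero
    have hev : (pol (fun i => P.coeff i)).eval α = 0 := by
      rw [← hP, eval_map_algebraMap, hα]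
    simp only [Finset.coe_biUnion, Set.mem_iUnion, Finset.mem_coe, exists_prop,
      Multiset.mem_toFinset]
    refine ⟨fun i => P.coeff i, ?_, ?_⟩
    · rw [mem_VSet]
      refine ⟨fun i => ?_, α, hS, ?_⟩
      · have := abs_le.1 (hht i)
        exact ⟨by exact_mod_cast this.1, by exact_mod_cast this.2⟩
      · rw [hpol] at hev
        simpa [eval_finsetSum] using hev
    · rw [mem_roots (by rwa [← hP])]
      exact hev
  refine ⟨(Finset.finite_toSet _).subset hsub, ?_⟩
  refine (Set.ncard_le_ncard hsub (Finset.finite_toSet _)).trans ?_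
  rw [Set.ncard_coe_finset]
  apply Finset.card_biUnion_le_card_mul
  intro a _
  refine (Multiset.toFinset_card_le _).trans ((card_roots' _).trans ?_)
  apply natDegree_sum_le_of_forall_le
  intro i _
  exact (natDegree_C_mul_X_pow_le _ _).trans (by omega)

/-- The constant in the upper bounds. -/
def KK (d : ℕ) : ℝ := d * 3 ^ d * (2 * (d + 1) * d + 1)

lemma KK_pos {d : ℕ} (hd : 2 ≤ d) : 0 < KK d := by
  have : (0 : ℝ) < d := by exact_mod_cast (by omega : 0 < d)
  unfold KK; positivity

lemma const_bound {d H : ℕ} (hH : 1 ≤ H) {w : ℝ} (hw : 0 ≤ w) :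
    (2 * (d + 1) * (H * (d * w)) + 1) * (2 * H + 1) ^ d * d ≤
      KK d * H ^ (d + 1) * (w + 1 / H) := by
  have hH' : (1 : ℝ) ≤ H := by exact_mod_cast hH
  have h1 : (2 * (H : ℝ) + 1) ^ d ≤ 3 ^ d * H ^ d := by
    rw [← mul_pow]; gcongr; linarith
  have h2 : 2 * ((d : ℝ) + 1) * (H * (d * w)) + 1 ≤ (2 * (d + 1) * d + 1) * (H * w + 1) := by
    have : 0 ≤ (H : ℝ) * w := by positivity
    have h3 : 0 ≤ 2 * ((d : ℝ) + 1) * d := by positivity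
    nlinarith
  calc _ ≤ ((2 * (d + 1) * d + 1) * (H * w + 1)) * (3 ^ d * (H : ℝ) ^ d) * d := by gcongr
    _ = _ := by
      unfold KK
      have : (H : ℝ) ≠ 0 := by positivity
      field_simp
      ring

lemma alg_bound1 {d H : ℕ} (hH : 1 ≤ H) {S : Set ℝ} {u v : ℝ} (hu : -1 ≤ u)
    (hv : v ≤ 1) (huv : u ≤ v) (hS : S ⊆ Icc u v) :
    ((algSet d H ∩ S).ncard : ℝ) ≤ KK d * H ^ (d + 1) * (v - u + 1 / H) := by
  refine le_trans ?_ (const_bound hH (by linarith : 0 ≤ v - u))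
  calc ((algSet d H ∩ S).ncard : ℝ) ≤ (VSet d H S).card * d := by
        exact_mod_cast (alg_count S).2
    _ ≤ _ := by
      gcongr
      exact VSet_card hu hv huv hS

lemma alg_bound2 {d H : ℕ} (hH : 1 ≤ H) {S : Set ℝ} {u v : ℝ} (hu : -1 ≤ u)
    (hv : v ≤ 1) (huv : u ≤ v) (h0 : ∀ x ∈ S, x ≠ 0) (hS : ∀ x ∈ S, x⁻¹ ∈ Icc u v) :
    ((algSet d H ∩ S).ncard : ℝ) ≤ KK d * H ^ (d + 1) * (v - u + 1 / H) := by
  refine le_trans ?_ (const_bound hH (by linarith : 0 ≤ v - u))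
  calc ((algSet d H ∩ S).ncard : ℝ) ≤ (VSet d H S).card * d := by
        exact_mod_cast (alg_count S).2
    _ ≤ (VSet d H ((fun x => x⁻¹) '' S)).card * d := by
      have := VSet_inv (d := d) (H := H) h0
      have h : ((VSet d H S).card : ℝ) ≤ (VSet d H ((fun x => x⁻¹) '' S)).card := by
        exact_mod_cast this
      gcongr
    _ ≤ _ := by
      gcongr
      apply VSet_card hu hv huv
      rintro _ ⟨x, hx, rfl⟩
      exact hS x hx

lemma count_true {d H : ℕ} (hd : 2 ≤ d) (hH : 1 ≤ H) {u v : ℝ} (hu : 0 ≤ u) (huv : u ≤ v)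
    (hv : v ≤ 1) :
    (({α : ℝ | α ∈ XSet d H true ∧ Int.fract α ∈ Icc u v}).ncard : ℝ) ≤
      12 * KK d * H ^ (d + 1) * (v - u + 1 / H) := by
  have hsub : {α : ℝ | α ∈ XSet d H true ∧ Int.fract α ∈ Icc u v} ⊆
      (algSet d H ∩ Icc u v) ∪ (algSet d H ∩ Icc 1 1) := by
    rintro α ⟨hα, hf⟩
    simp only [XSet, if_true] at hα
    obtain ⟨hα, h0, h1⟩ := hα
    rcases h1.lt_or_eq with h | h
    · left
      rw [Int.fract_eq_self.2 ⟨h0, h⟩] at hf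
      exact ⟨hα, hf⟩
    · right
      exact ⟨hα, by simp [h]⟩
  have h1 := alg_bound1 (d := d) hH (u := u) (v := v) (by linarith) hv huv subset_rfl
  have h2 := alg_bound1 (d := d) hH (u := 1) (v := 1) (by linarith) le_rfl le_rfl subset_rfl
  have h3 : ({α : ℝ | α ∈ XSet d H true ∧ Int.fract α ∈ Icc u v}).ncard ≤
      (algSet d H ∩ Icc u v).ncard + (algSet d H ∩ Icc 1 1).ncard :=
    (Set.ncard_le_ncard hsub ((alg_count _).1.union (alg_count _).1)).trans
      (Set.ncard_union_le _ _)
  have h4 : (({α : ℝ | α ∈ XSet d H true ∧ Int.fract α ∈ Icc u v}).ncard : ℝ) ≤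
      (algSet d H ∩ Icc u v).ncard + (algSet d H ∩ Icc 1 1).ncard := by exact_mod_cast h3
  have hK : 0 ≤ KK d * (H : ℝ) ^ (d + 1) := by have := KK_pos hd; positivity
  have h5 : 0 ≤ KK d * (H : ℝ) ^ (d + 1) * (v - u) := mul_nonneg hK (by linarith)
  have h6 : 0 ≤ KK d * (H : ℝ) ^ (d + 1) * (1 / H) := by positivity
  nlinarith

lemma cell_pos {d H : ℕ} (hd : 2 ≤ d) (hH : 1 ≤ H) {u v : ℝ} (hu : 0 ≤ u) (huv : u ≤ v)
    (hv : v ≤ 1) (k : ℕ) :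
    ((algSet d H ∩ Icc (k + u) (k + v)).ncard : ℝ) ≤
      KK d * H ^ (d + 1) * ((v - u) * (6 / ((k + 1) * (k + 2))) + 1 / H) ∧
    ((algSet d H ∩ Icc (-(k + v)) (-(k + u))).ncard : ℝ) ≤
      KK d * H ^ (d + 1) * ((v - u) * (6 / ((k + 1) * (k + 2))) + 1 / H) := by
  have hK : 0 ≤ KK d * (H : ℝ) ^ (d + 1) := by have := KK_pos hd; positivity
  rcases Nat.eq_zero_or_pos k with rfl | hk
  · have h1 := alg_bound1 (d := d) hH (u := u) (v := v) (by linarith) hv huv subset_rfl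
    have h2 := alg_bound1 (d := d) hH (u := -v) (v := -u) (by linarith) (by linarith)
      (by linarith) subset_rfl
    have h3 : v - u ≤ (v - u) * (6 / (((0 : ℕ) + 1) * ((0 : ℕ) + 2))) := by
      norm_num; linarith
    simp only [Nat.cast_zero, zero_add] at h3 ⊢
    constructor
    · refine h1.trans ?_
      gcongr
    · refine h2.trans ?_
      gcongr
      linarith
  · have hk' : (1 : ℝ) ≤ k := by exact_mod_cast hk
    have p1 : 0 < k + u := by linarith
    have p2 : 0 < k + v := by linarith
    have e1 : (k + u)⁻¹ ≤ 1 := inv_le_one_of_one_le₀ (by linarith)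
    have e2 : (k + v)⁻¹ ≤ 1 := inv_le_one_of_one_le₀ (by linarith)
    have e3 : 0 < (k + v)⁻¹ := inv_pos.2 p2
    have e4 : (k + v)⁻¹ ≤ (k + u)⁻¹ := by gcongr
    have hw : (k + u)⁻¹ - (k + v)⁻¹ ≤ (v - u) * (6 / ((k + 1) * (k + 2))) := by
      have : (k + u)⁻¹ - (k + v)⁻¹ = (v - u) * (1 / ((k + u) * (k + v))) := by
        field_simp; ring
      rw [this]
      apply mul_le_mul_of_nonneg_left _ (by linarith)
      rw [div_le_div_iff₀ (by positivity) (by positivity)]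
      have : (k : ℝ) * k ≤ (k + u) * (k + v) := by
        apply mul_le_mul <;> linarith
      nlinarith
    constructor
    · refine (alg_bound2 (d := d) hH (u := (k + v)⁻¹) (v := (k + u)⁻¹) (by linarith) e1 e4
        ?_ ?_).trans (by gcongr)
      · intro x hx; have := hx.1; exact ne_of_gt (by linarith)
      · intro x hx
        have h1 := hx.1
        have h2 := hx.2
        have : 0 < x := by linarith
        exact ⟨by gcongr, by gcongr⟩
    · refine (alg_bound2 (d := d) hH (u := -(k + u)⁻¹) (v := -(k + v)⁻¹) (by linarith)
        (by linarith) (by linarith) ?_ ?_).trans ?_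
      · intro x hx; have := hx.2; exact ne_of_lt (by linarith)
      · intro x hx
        have h1 := hx.1
        have h2 := hx.2
        have h3 : 0 < -x := by linarith
        have a1 : (-x)⁻¹ ≤ (k + u)⁻¹ := by gcongr; linarith
        have a2 : (k + v)⁻¹ ≤ (-x)⁻¹ := by gcongr; linarith
        rw [inv_neg] at a1 a2
        exact ⟨by linarith, by linarith⟩
      · gcongr
        linarith

lemma sum_tele (T : ℕ) : ∑ k ∈ Finset.range T, (6 / (((k : ℝ) + 1) * (k + 2))) ≤ 6 := by
  have : ∑ k ∈ Finset.range T, (6 / (((k : ℝ) + 1) * (k + 2))) = 6 - 6 / (T + 1) := by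
    induction T with
    | zero => simp
    | succ n ih =>
      rw [Finset.sum_range_succ, ih]
      push_cast
      field_simp
      ring
  rw [this]
  have : (0 : ℝ) ≤ 6 / (T + 1) := by positivity
  linarith

lemma count_false {d H : ℕ} (hd : 2 ≤ d) (hH : 1 ≤ H) {u v : ℝ} (hu : 0 ≤ u) (huv : u ≤ v)
    (hv : v ≤ 1) :
    (({α : ℝ | α ∈ XSet d H false ∧ Int.fract α ∈ Icc u v}).ncard : ℝ) ≤
      12 * KK d * H ^ (d + 1) * (v - u + 1 / √H) := by
  classical
  have hH' : (1 : ℝ) ≤ H := by exact_mod_cast hH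
  have hs1 : 1 ≤ √(H : ℝ) := Real.one_le_sqrt.2 hH'
  have hss : √(H : ℝ) * √(H : ℝ) = H := Real.mul_self_sqrt (by linarith)
  set T : ℕ := ⌈√(H : ℝ)⌉₊ with hT
  have hT1 : √(H : ℝ) ≤ T := Nat.le_ceil _
  have hT2 : (T : ℝ) ≤ 2 * √(H : ℝ) := by
    have := Nat.ceil_lt_add_one (Real.sqrt_nonneg (H : ℝ))
    linarith
  set A : ℕ → Set ℝ := fun k => algSet d H ∩ Icc (k + u) (k + v) with hA
  set B : ℕ → Set ℝ := fun k => algSet d H ∩ Icc (-(k + (1 - u))) (-(k + (1 - v))) with hB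
  set R : Set ℝ := algSet d H ∩ {x | (T : ℝ) ≤ |x|} with hR
  have hAf : ∀ k, (A k).Finite := fun k => (alg_count _).1
  have hBf : ∀ k, (B k).Finite := fun k => (alg_count _).1
  have hRf : R.Finite := (alg_count _).1
  set F : Finset ℝ := ((Finset.range T).biUnion fun k => ((hAf k).toFinset ∪ (hBf k).toFinset)) ∪
    hRf.toFinset with hF
  have hsub : {α : ℝ | α ∈ XSet d H false ∧ Int.fract α ∈ Icc u v} ⊆ (F : Set ℝ) := by
    rintro α ⟨hα, hf⟩
    simp only [XSet] at hα
    have hα : α ∈ algSet d H := by simpa using hα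
    by_cases hb : (T : ℝ) ≤ |α|
    · simp only [hF, Finset.coe_union, Set.mem_union, Set.Finite.coe_toFinset]
      right
      exact ⟨hα, hb⟩
    · push Not at hb
      rw [abs_lt] at hb
      have hfl : (⌊α⌋ : ℝ) + Int.fract α = α := Int.floor_add_fract α
      simp only [hF, Finset.mem_coe, Finset.mem_union, Finset.mem_biUnion,
        Set.Finite.mem_toFinset, Finset.mem_range]
      left
      rcases le_or_gt 0 ⌊α⌋ with hn | hn
      · obtain ⟨k, hk⟩ := Int.eq_ofNat_of_zero_le hn
        rw [hk] at hfl
        push_cast at hfl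
        have hfn := Int.fract_nonneg α
        refine ⟨k, ?_, Or.inl ⟨hα, ?_⟩⟩
        · have : (k : ℝ) < T := by linarith
          exact_mod_cast this
        · exact ⟨by linarith [hf.1], by linarith [hf.2]⟩
      · obtain ⟨k, hk⟩ := Int.eq_ofNat_of_zero_le (show 0 ≤ -⌊α⌋ - 1 by omega)
        have hk' : ⌊α⌋ = -(k : ℤ) - 1 := by omega
        rw [hk'] at hfl
        push_cast at hfl
        have hfn := Int.fract_lt_one α
        refine ⟨k, ?_, Or.inr ⟨hα, ?_⟩⟩
        · have : (k : ℝ) < T := by linarith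
          exact_mod_cast this
        · exact ⟨by linarith [hf.1], by linarith [hf.2]⟩
  have h1 : ({α : ℝ | α ∈ XSet d H false ∧ Int.fract α ∈ Icc u v}).ncard ≤
      (∑ k ∈ Finset.range T, ((A k).ncard + (B k).ncard)) + R.ncard := by
    refine (Set.ncard_le_ncard hsub (Finset.finite_toSet _)).trans ?_
    rw [Set.ncard_coe_finset]
    refine (Finset.card_union_le _ _).trans ?_
    rw [Set.ncard_eq_toFinset_card R hRf]
    gcongr
    refine Finset.card_biUnion_le.trans ?_
    gcongr with k _
    refine (Finset.card_union_le _ _).trans ?_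
    rw [Set.ncard_eq_toFinset_card _ (hAf k), Set.ncard_eq_toFinset_card _ (hBf k)]
  have h2 : (({α : ℝ | α ∈ XSet d H false ∧ Int.fract α ∈ Icc u v}).ncard : ℝ) ≤
      (∑ k ∈ Finset.range T, (((A k).ncard : ℝ) + (B k).ncard)) + R.ncard := by
    exact_mod_cast h1
  set K : ℝ := KK d * (H : ℝ) ^ (d + 1) with hKdef
  have hK : 0 ≤ K := by have := KK_pos hd; positivity
  have h3 : ∑ k ∈ Finset.range T, (((A k).ncard : ℝ) + (B k).ncard) ≤
      ∑ k ∈ Finset.range T, (2 * K * (v - u) * (6 / (((k : ℝ) + 1) * (k + 2))) + 2 * K * (1 / H)) := by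
    apply Finset.sum_le_sum
    intro k _
    have a1 := (cell_pos hd hH hu huv hv k).1
    have a2 := (cell_pos hd hH (u := 1 - v) (v := 1 - u) (by linarith) (by linarith)
      (by linarith) k).2
    rw [show (1 - u - (1 - v)) = v - u by ring] at a2
    rw [← hKdef] at a1 a2
    calc _ ≤ _ := add_le_add a1 a2
      _ = _ := by ring
  have h4 : ∑ k ∈ Finset.range T,
      (2 * K * (v - u) * (6 / (((k : ℝ) + 1) * (k + 2))) + 2 * K * (1 / H)) ≤
      2 * K * (v - u) * 6 + T * (2 * K * (1 / H)) := by
    rw [Finset.sum_add_distrib, ← Finset.mul_sum]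
    have := sum_tele T
    have h0 : 0 ≤ v - u := by linarith
    simp only [Finset.sum_const, Finset.card_range, nsmul_eq_mul]
    gcongr
  have hTp : (0 : ℝ) < T := by linarith
  have h5 : (R.ncard : ℝ) ≤ K * (2 / T + 1 / H) := by
    have hi : (T : ℝ)⁻¹ ≤ 1 := inv_le_one_of_one_le₀ (by linarith)
    have hi0 : 0 < (T : ℝ)⁻¹ := inv_pos.2 hTp
    refine (alg_bound2 (d := d) hH (u := -(T : ℝ)⁻¹) (v := (T : ℝ)⁻¹) (by linarith) hi
      (by linarith) ?_ ?_).trans (le_of_eq ?_)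
    · rintro x hx rfl
      simp only [Set.mem_ofPred_eq, abs_zero] at hx
      linarith
    · intro x hx
      rw [Set.mem_Icc, ← abs_le, abs_inv]
      have : (T : ℝ) ≤ |x| := hx
      gcongr
    · rw [hKdef]; ring
  have hsp : 0 < √(H : ℝ) := by linarith
  have b1 : T * (1 / (H : ℝ)) ≤ 2 * (1 / √(H : ℝ)) := by
    calc T * (1 / (H : ℝ)) ≤ (2 * √(H : ℝ)) * (1 / (√(H : ℝ) * √(H : ℝ))) := by rw [hss]; gcongr
      _ = _ := by field_simp
  have b2 : 2 / (T : ℝ) ≤ 2 * (1 / √(H : ℝ)) := by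
    rw [mul_one_div]; gcongr
  have b3 : 1 / (H : ℝ) ≤ 1 / √(H : ℝ) := by
    apply one_div_le_one_div_of_le hsp
    nlinarith
  have hq : 0 ≤ 1 / √(H : ℝ) := by positivity
  calc _ ≤ _ := h2
    _ ≤ 2 * K * (v - u) * 6 + T * (2 * K * (1 / H)) + K * (2 / T + 1 / H) := by linarith
    _ = K * (12 * (v - u) + 2 * (T * (1 / H)) + 2 / T + 1 / H) := by ring
    _ ≤ K * (12 * (v - u + 1 / √(H : ℝ))) := by
      apply mul_le_mul_of_nonneg_left _ hK
      linarith
    _ = _ := by rw [hKdef]; ring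

/-- The basic error term. -/
def ee (prime : Bool) (H : ℕ) : ℝ := if prime then 1 / H else 1 / √H

lemma count_both {d H : ℕ} (hd : 2 ≤ d) (prime : Bool) (hH : 1 ≤ H) {u v : ℝ} (hu : 0 ≤ u)
    (huv : u ≤ v) (hv : v ≤ 1) :
    (({α : ℝ | α ∈ XSet d H prime ∧ Int.fract α ∈ Icc u v}).ncard : ℝ) ≤
      12 * KK d * H ^ (d + 1) * (v - u + ee prime H) := by
  cases prime
  · simpa [ee] using count_false hd hH hu huv hv
  · simpa [ee] using count_true hd hH hu huv hv

lemma XSet_finite (d H : ℕ) (prime : Bool) : (XSet d H prime).Finite := by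
  have : (algSet d H).Finite := by simpa using (alg_count (d := d) (H := H) univ).1
  apply this.subset
  intro x hx
  cases prime
  · simpa [XSet] using hx
  · simp only [XSet, if_true] at hx
    exact hx.1

lemma ErrTerm_ge {d H : ℕ} (prime : Bool) (hH : 3 ≤ H) :
    16 * ee prime H ≤ ErrTerm prime 16 d H := by
  have hH' : (3 : ℝ) ≤ H := by exact_mod_cast hH
  have hl : 1 ≤ Real.log H := by
    rw [Real.le_log_iff_exp_le (by linarith)]
    have := Real.exp_one_lt_d9
    linarith
  have hl' : 1 ≤ Real.log H ^ lfun d := one_le_pow₀ hl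
  cases prime
  · simp only [ee, ErrTerm, Bool.false_eq_true, if_false]
    rw [← Real.sqrt_one, ← Real.sqrt_div (by norm_num)]
    gcongr
  · simp only [ee, ErrTerm, if_true]
    rw [mul_div_assoc]
    gcongr

/-- Coefficients of the special (Eisenstein at `2`) polynomials. -/
def co (d M : ℕ) (i : Fin (d + 1)) (n : ℕ) : ℤ :=
  if (i : ℕ) = 0 then -(4 * (n : ℤ) + 2) else if (i : ℕ) = d then 4 * (M : ℤ) + 2 * n + 1
    else 2 * (n : ℤ)

/-- The special polynomials. -/
def qp (d M : ℕ) (x : Fin (d + 1) → ℕ) : ℤ[X] := ∑ i, C (co d M i (x i)) * X ^ (i : ℕ)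

lemma qp_coeff {d M : ℕ} (x : Fin (d + 1) → ℕ) (i : Fin (d + 1)) :
    (qp d M x).coeff i = co d M i (x i) := by
  simp only [qp, finsetSum_coeff, coeff_C_mul, coeff_X_pow, mul_ite, mul_one, mul_zero]
  rw [Finset.sum_eq_single i]
  · simp
  · intro j _ hj
    rw [if_neg]
    intro h
    exact hj (Fin.ext h.symm)
  · simp

lemma qp_coeff_ge {d M : ℕ} (x : Fin (d + 1) → ℕ) {k : ℕ} (hk : d < k) :
    (qp d M x).coeff k = 0 := by
  simp only [qp, finsetSum_coeff, coeff_C_mul, coeff_X_pow, mul_ite, mul_one, mul_zero]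
  apply Finset.sum_eq_zero
  intro j _
  rw [if_neg]
  omega

lemma qp_coeff_zero {d M : ℕ} (x : Fin (d + 1) → ℕ) :
    (qp d M x).coeff 0 = -(4 * (x 0 : ℤ) + 2) := by
  have := qp_coeff (M := M) x 0
  simpa [co] using this

lemma qp_coeff_last {d M : ℕ} (hd : 2 ≤ d) (x : Fin (d + 1) → ℕ) :
    (qp d M x).coeff d = 4 * (M : ℤ) + 2 * (x (Fin.last d)) + 1 := by
  have := qp_coeff (M := M) x (Fin.last d)
  simp only [co, Fin.val_last, if_true] at this
  rw [this, if_neg (by omega)]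

lemma qp_natDegree {d M : ℕ} (hd : 2 ≤ d) (x : Fin (d + 1) → ℕ) :
    (qp d M x).natDegree = d := by
  apply natDegree_eq_of_le_of_coeff_ne_zero
  · rw [natDegree_le_iff_coeff_eq_zero]
    exact fun k hk => qp_coeff_ge x hk
  · rw [qp_coeff_last hd]; omega

lemma qp_irred {d M : ℕ} (hd : 2 ≤ d) (x : Fin (d + 1) → ℕ) (hp : (qp d M x).IsPrimitive) :
    Irreducible (qp d M x) := by
  have hdeg := qp_natDegree (M := M) hd x
  have hne : qp d M x ≠ 0 := hp.ne_zero
  refine irreducible_of_eisenstein_criterion (P := Ideal.span {(2 : ℤ)}) ?_ ?_ ?_ ?_ ?_ hp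
  · rw [Ideal.span_singleton_prime (by norm_num)]
    exact Int.prime_two
  · rw [leadingCoeff, hdeg, qp_coeff_last hd, Ideal.mem_span_singleton]
    omega
  · intro n hn
    rw [degree_eq_natDegree hne, hdeg] at hn
    have hn : n < d := by exact_mod_cast hn
    have := qp_coeff (M := M) x ⟨n, by omega⟩
    simp only at this
    rw [this, Ideal.mem_span_singleton, co]
    simp only
    split_ifs
    · omega
    · omega
    · omega
  · rw [degree_eq_natDegree hne, hdeg]
    exact_mod_cast (by omega : 0 < d)
  · rw [Ideal.span_singleton_pow, Ideal.mem_span_singleton, qp_coeff_zero]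
    omega

lemma qp_height {d M H : ℕ} (hMH : 6 * M ≤ H) (x : Fin (d + 1) → ℕ)
    (hx : ∀ i, x i < M) (k : ℕ) : |((qp d M x).coeff k : ℝ)| ≤ H := by
  have : |(qp d M x).coeff k| ≤ (H : ℤ) := by
    rcases Nat.lt_or_ge d k with hk | hk
    · rw [qp_coeff_ge x hk]; simp
    · have := qp_coeff (M := M) x ⟨k, by omega⟩
      simp only at this
      rw [this, co]
      have := hx ⟨k, by omega⟩
      rw [abs_le]
      split_ifs <;> constructor <;> omega
  exact_mod_cast this

lemma qp_root {d M : ℕ} (hd : 2 ≤ d) (x : Fin (d + 1) → ℕ) (hx : ∀ i, x i < M) :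
    ∃ α ∈ Icc (0 : ℝ) 1, aeval α (qp d M x) = 0 := by
  have hcont : ContinuousOn (fun α : ℝ => aeval α (qp d M x)) (Icc 0 1) :=
    (Polynomial.continuous_aeval _).continuousOn
  have h := intermediate_value_Icc (zero_le_one) hcont
  apply h
  constructor
  · rw [← coeff_zero_eq_aeval_zero', qp_coeff_zero]
    simp only [eq_intCast]
    push_cast
    have : (0 : ℝ) ≤ x 0 := by positivity
    linarith
  · have : aeval (1 : ℝ) (qp d M x) = ((∑ i, co d M i (x i) : ℤ) : ℝ) := by
      simp [qp]
    rw [this]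
    have h2 : 0 ≤ ∑ i, co d M i (x i) := by
      rw [Fin.sum_univ_succ]
      have hl : co d M (Fin.last d) (x (Fin.last d)) ≤
          ∑ i : Fin d, co d M i.succ (x i.succ) := by
        have e : (Fin.last d) = (⟨d - 1, by omega⟩ : Fin d).succ := by
          ext; simp; omega
        rw [e]
        apply Finset.single_le_sum (f := fun i : Fin d => co d M i.succ (x i.succ)) _
          (Finset.mem_univ _)
        intro i _
        change 0 ≤ co d M i.succ (x i.succ)
        unfold co
        rw [if_neg (by simp)]
        split_ifs <;> positivity
      have h0 : co d M 0 (x 0) = -(4 * (x 0 : ℤ) + 2) := by simp [co]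
      have h1 : co d M (Fin.last d) (x (Fin.last d)) = 4 * (M : ℤ) + 2 * (x (Fin.last d)) + 1 := by
        simp only [co, Fin.val_last, if_true]
        rw [if_neg (by omega)]
      have := hx 0
      omega
    exact_mod_cast h2

lemma qp_inj {d M : ℕ} {x y : Fin (d + 1) → ℕ} (h : qp d M x = qp d M y) : x = y := by
  funext i
  have h1 := qp_coeff (M := M) x i
  have h2 := qp_coeff (M := M) y i
  rw [h, h2, co, co] at h1
  split_ifs at h1 <;> omega

lemma eq_of_root {P Q : ℤ[X]} (hP : Irreducible P) (hQ : Irreducible Q) (hPd : P.natDegree ≠ 0)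
    (hQd : Q.natDegree ≠ 0) (hPl : 0 < P.leadingCoeff) (hQl : 0 < Q.leadingCoeff) {α : ℝ}
    (h1 : aeval α P = 0) (h2 : aeval α Q = 0) : P = Q := by
  have key : ∀ {P Q : ℤ[X]}, Irreducible P → P.natDegree ≠ 0 → aeval α P = 0 → aeval α Q = 0 →
      P ∣ Q := by
    intro P Q hP hPd h1 h2
    have hprim := hP.isPrimitive hPd
    rw [IsPrimitive.Int.dvd_iff_map_cast_dvd_map_cast _ _ hprim]
    have hirr := (IsPrimitive.Int.irreducible_iff_irreducible_map_cast hprim).1 hP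
    have a1 : aeval α (P.map (Int.castRingHom ℚ)) = 0 := by
      rw [← h1]; exact aeval_map_algebraMap ℚ α P
    have a2 : aeval α (Q.map (Int.castRingHom ℚ)) = 0 := by
      rw [← h2]; exact aeval_map_algebraMap ℚ α Q
    have e := minpoly.eq_of_irreducible hirr a1
    exact (Dvd.intro _ e).trans (minpoly.dvd ℚ α a2)
  obtain ⟨u, hu⟩ := associated_of_dvd_dvd (key hP hPd h1 h2) (key hQ hQd h2 h1)
  obtain ⟨r, hr, hru⟩ := Polynomial.isUnit_iff.1 u.isUnit
  rcases Int.isUnit_iff.1 hr with rfl | rfl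
  · rw [← hu, ← hru]; simp
  · rw [← hu, ← hru] at hQl
    simp at hQl
    omega

lemma class_card {c : ℕ} (hc : Odd c) (M s : ℕ) :
    ((Finset.range M).filter (fun x => c ∣ 2 * x + s)).card ≤ M / c + 1 := by
  rw [← Finset.card_range (M / c + 1)]
  apply Finset.card_le_card_of_injOn (fun x => x / c)
  · intro x hx
    simp only [Finset.coe_filter, Finset.mem_range, Set.mem_ofPred_eq] at hx
    simp only [Finset.coe_range, Set.mem_Iio]
    have := Nat.div_le_div_right (c := c) hx.1.le
    omega
  · intro x hx y hy h
    simp only [Finset.coe_filter, Finset.mem_range, Set.mem_ofPred_eq] at hx hy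
    simp only at h
    have h1 : (2 * x + s) ≡ (2 * y + s) [MOD c] :=
      ((Nat.modEq_zero_iff_dvd).2 hx.2).trans ((Nat.modEq_zero_iff_dvd).2 hy.2).symm
    have h2 : 2 * x ≡ 2 * y [MOD c] := Nat.ModEq.add_right_cancel' s h1
    have h3 : x ≡ y [MOD c] := by
      refine Nat.ModEq.cancel_left_of_coprime ?_ h2
      exact (Nat.coprime_two_right.2 hc)
    rw [← Nat.div_add_mod x c, ← Nat.div_add_mod y c, h, h3]

/-- Offsets. -/
def off (d M : ℕ) (i : Fin (d + 1)) : ℕ :=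
  if (i : ℕ) = 0 then 1 else if (i : ℕ) = d then 4 * M + 1 else 0

/-- Vectors divisible by `c`. -/
def badSet (d M c : ℕ) : Finset (Fin (d + 1) → ℕ) :=
  Fintype.piFinset fun i => (Finset.range M).filter (fun x => c ∣ 2 * x + off d M i)

lemma badSet_card {d M c : ℕ} (hc : Odd c) : (badSet d M c).card ≤ (M / c + 1) ^ (d + 1) := by
  rw [badSet, Fintype.card_piFinset]
  calc _ ≤ ∏ i : Fin (d + 1), (M / c + 1) :=
        Finset.prod_le_prod' (fun i _ => class_card hc M _)
    _ = _ := by simp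

lemma not_prim {d M : ℕ} (hd : 2 ≤ d) (x : Fin (d + 1) → ℕ) (hx : ∀ i, x i < M)
    (hp : ¬ (qp d M x).IsPrimitive) :
    ∃ c, 3 ≤ c ∧ c < 2 * M ∧ Odd c ∧ x ∈ badSet d M c := by
  unfold IsPrimitive at hp
  push Not at hp
  obtain ⟨r, hr, hru⟩ := hp
  rw [C_dvd_iff_dvd_coeff] at hr
  have hru' : r.natAbs ≠ 1 := by rwa [Int.isUnit_iff_natAbs_eq] at hru
  have hl := hr d
  rw [qp_coeff_last hd] at hl
  have hodd : Odd r.natAbs := by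
    rw [← Nat.not_even_iff_odd]
    intro he
    have h2 : (2 : ℤ) ∣ r := by
      rw [← Int.natAbs_dvd_natAbs]; exact even_iff_two_dvd.1 he
    have := h2.trans hl
    omega
  have hcop : IsCoprime r 2 := by
    rw [Int.isCoprime_iff_gcd_eq_one]
    exact Nat.coprime_two_right.2 hodd
  have hdvd : ∀ i, r.natAbs ∣ 2 * x i + off d M i := by
    intro i
    have h := hr i
    rw [qp_coeff] at h
    have : r ∣ 2 * (x i : ℤ) + off d M i := by
      unfold co at h
      unfold off
      split_ifs at h ⊢
      · have e : -(4 * (x i : ℤ) + 2) = 2 * (-(2 * (x i : ℤ) + 1)) := by ring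
        rw [e] at h
        have := hcop.dvd_of_dvd_mul_left h
        rw [dvd_neg] at this
        simpa using this
      · push_cast
        rw [show (2 * (x i : ℤ) + (4 * M + 1)) = 4 * M + 2 * x i + 1 by ring]
        exact h
      · simpa using h
    rw [← Int.natCast_dvd_natCast, Int.natAbs_dvd]
    exact_mod_cast this
  refine ⟨r.natAbs, ?_, ?_, hodd, ?_⟩
  · rcases hodd with ⟨k, hk⟩
    omega
  · have := hdvd 0
    have e : off d M 0 = 1 := by simp [off]
    rw [e] at this
    have h1 := Nat.le_of_dvd (by omega) this
    have := hx 0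
    omega
  · simp only [badSet, Fintype.mem_piFinset, Finset.mem_filter, Finset.mem_range]
    exact fun i => ⟨hx i, hdvd i⟩

lemma sum_inv_sq (m : ℕ) : ∑ j ∈ Finset.range m, 1 / ((j : ℝ) + 3) ^ 2 ≤
    1 / 2 - 1 / ((m : ℝ) + 2) := by
  induction m with
  | zero => simp
  | succ n ih =>
    rw [Finset.sum_range_succ]
    have h : 1 / ((n : ℝ) + 3) ^ 2 ≤ 1 / (n + 2) - 1 / (n + 3) := by
      have : 1 / ((n : ℝ) + 2) - 1 / (n + 3) = 1 / ((n + 2) * (n + 3)) := by field_simp; ring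
      rw [this]
      apply one_div_le_one_div_of_le (by positivity)
      nlinarith
    push_cast
    rw [show (n : ℝ) + 1 + 2 = n + 3 by ring]
    linarith

lemma sum_cubes {M : ℕ} (hM : 12 ≤ M) :
    ∑ c ∈ Finset.Ico 3 (2 * M), ((M : ℝ) / c + 1) ^ 3 ≤ (M : ℝ) ^ 3 / 2 := by
  have hM' : (12 : ℝ) ≤ M := by exact_mod_cast hM
  have h1 : ∀ c ∈ Finset.Ico 3 (2 * M), ((M : ℝ) / c + 1) ^ 3 ≤
      ((M : ℝ) ^ 3 / 3 + 3 * M ^ 2) * (1 / (c : ℝ) ^ 2) + (M + 1) := by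
    intro c hc
    have hc3 : (3 : ℝ) ≤ c := by exact_mod_cast (Finset.mem_Ico.1 hc).1
    have hcp : (0 : ℝ) < c := by linarith
    have e : ((M : ℝ) / c + 1) ^ 3 = (M : ℝ) ^ 3 * (1 / c) * (1 / c ^ 2) + 3 * M ^ 2 * (1 / c ^ 2)
        + 3 * M * (1 / c) + 1 := by field_simp; ring
    have hi : 1 / (c : ℝ) ≤ 1 / 3 := one_div_le_one_div_of_le (by norm_num) hc3
    rw [e]
    have a1 : (M : ℝ) ^ 3 * (1 / c) * (1 / (c : ℝ) ^ 2) ≤ (M : ℝ) ^ 3 * (1 / 3) * (1 / c ^ 2) := by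
      gcongr
    have a2 : 3 * (M : ℝ) * (1 / c) ≤ 3 * M * (1 / 3) := by gcongr
    nlinarith
  refine (Finset.sum_le_sum h1).trans ?_
  rw [Finset.sum_add_distrib, ← Finset.mul_sum, Finset.sum_const, Nat.card_Ico, nsmul_eq_mul]
  have h2 : ∑ c ∈ Finset.Ico 3 (2 * M), (1 / (c : ℝ) ^ 2) ≤ 1 / 2 := by
    rw [Finset.sum_Ico_eq_sum_range]
    have := sum_inv_sq (2 * M - 3)
    have h0 : (0 : ℝ) ≤ 1 / (((2 * M - 3 : ℕ) : ℝ) + 2) := by positivity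
    refine le_trans (le_of_eq ?_) (this.trans (by linarith))
    apply Finset.sum_congr rfl
    intro j _
    push_cast
    rw [add_comm]
  have h3 : (((2 * M - 3 : ℕ)) : ℝ) ≤ 2 * M := by exact_mod_cast Nat.sub_le _ _
  calc _ ≤ ((M : ℝ) ^ 3 / 3 + 3 * M ^ 2) * (1 / 2) + 2 * M * (M + 1) := by gcongr
    _ ≤ _ := by nlinarith [sq_nonneg (M : ℝ), mul_nonneg (sq_nonneg (M : ℝ)) (by linarith : (0:ℝ) ≤ M - 12)]

lemma good_card {d M : ℕ} (hd : 2 ≤ d) (hM : 12 ≤ M) :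
    ∃ G : Finset (Fin (d + 1) → ℕ), (M : ℝ) ^ (d + 1) / 2 ≤ G.card ∧
      ∀ x ∈ G, (∀ i, x i < M) ∧ (qp d M x).IsPrimitive := by
  classical
  set box : Finset (Fin (d + 1) → ℕ) := Fintype.piFinset fun _ => Finset.range M with hbox
  set bad := ((Finset.Ico 3 (2 * M)).filter Odd).biUnion (badSet d M) with hbad
  have hM' : (12 : ℝ) ≤ M := by exact_mod_cast hM
  have hboxc : box.card = M ^ (d + 1) := by simp [hbox, Fintype.card_piFinset]
  have hbadc : (bad.card : ℝ) ≤ (M : ℝ) ^ (d + 1) / 2 := by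
    have h1 : (bad.card : ℝ) ≤ ∑ c ∈ (Finset.Ico 3 (2 * M)).filter Odd,
        ((badSet d M c).card : ℝ) := by
      exact_mod_cast Finset.card_biUnion_le
    obtain ⟨e, rfl⟩ := Nat.exists_eq_add_of_le hd
    calc _ ≤ _ := h1
      _ ≤ ∑ c ∈ (Finset.Ico 3 (2 * M)).filter Odd, ((M : ℝ) / c + 1) ^ 3 * M ^ e := by
        apply Finset.sum_le_sum
        intro c hc
        rw [Finset.mem_filter, Finset.mem_Ico] at hc
        have hc3 : (3 : ℝ) ≤ c := by exact_mod_cast hc.1.1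
        have hb : ((badSet (2 + e) M c).card : ℝ) ≤ ((M / c + 1 : ℕ) : ℝ) ^ (2 + e + 1) := by
          exact_mod_cast badSet_card hc.2
        have hle : ((M / c + 1 : ℕ) : ℝ) ≤ (M : ℝ) / c + 1 := by
          push_cast
          have := Nat.cast_div_le (α := ℝ) (m := M) (n := c)
          linarith
        have hle2 : (M : ℝ) / c + 1 ≤ M := by
          have : (M : ℝ) / c ≤ M / 3 := by gcongr
          linarith
        calc _ ≤ _ := hb
          _ ≤ ((M : ℝ) / c + 1) ^ (2 + e + 1) := by gcongr
          _ = ((M : ℝ) / c + 1) ^ 3 * ((M : ℝ) / c + 1) ^ e := by ring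
          _ ≤ _ := by gcongr
      _ ≤ ∑ c ∈ (Finset.Ico 3 (2 * M)), ((M : ℝ) / c + 1) ^ 3 * M ^ e := by
        apply Finset.sum_le_sum_of_subset_of_nonneg (Finset.filter_subset _ _)
        intros; positivity
      _ = (∑ c ∈ (Finset.Ico 3 (2 * M)), ((M : ℝ) / c + 1) ^ 3) * M ^ e := by
        rw [Finset.sum_mul]
      _ ≤ ((M : ℝ) ^ 3 / 2) * M ^ e := by
        gcongr
        exact sum_cubes hM
      _ = _ := by ring
  refine ⟨box \ bad, ?_, ?_⟩
  · have h := Finset.le_card_sdiff bad box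
    have h2 : box.card ≤ (box \ bad).card + bad.card := by omega
    have h3 : (box.card : ℝ) ≤ (box \ bad).card + bad.card := by exact_mod_cast h2
    rw [hboxc] at h3
    push_cast at h3
    linarith
  · intro x hx
    rw [Finset.mem_sdiff, hbox, Fintype.mem_piFinset] at hx
    have hx1 : ∀ i, x i < M := fun i => by simpa using hx.1 i
    refine ⟨hx1, ?_⟩
    by_contra hp
    obtain ⟨c, h3, h4, h5, h6⟩ := not_prim hd x hx1 hp
    apply hx.2
    rw [hbad, Finset.mem_biUnion]
    exact ⟨c, by simp [h3, h4, h5], h6⟩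

lemma lower {d H : ℕ} (hd : 2 ≤ d) (prime : Bool) (hH : 72 ≤ H) :
    (1 / (2 * 12 ^ (d + 1)) : ℝ) * H ^ (d + 1) ≤ (XSet d H prime).ncard := by
  classical
  set M := H / 6 with hM
  have hM12 : 12 ≤ M := by omega
  have hMH : 6 * M ≤ H := by omega
  obtain ⟨G, hG, hGp⟩ := good_card hd hM12
  have hroot : ∀ x : Fin (d + 1) → ℕ, ∃ α : ℝ, x ∈ G → α ∈ Icc (0 : ℝ) 1 ∧
      aeval α (qp d M x) = 0 := by
    intro x
    by_cases hx : x ∈ G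
    · obtain ⟨α, h1, h2⟩ := qp_root hd x (hGp x hx).1
      exact ⟨α, fun _ => ⟨h1, h2⟩⟩
    · exact ⟨0, fun h => absurd h hx⟩
  choose f hf using hroot
  have hinj : Set.InjOn f (G : Set (Fin (d + 1) → ℕ)) := by
    intro x hx y hy hxy
    have hx := Finset.mem_coe.1 hx
    have hy := Finset.mem_coe.1 hy
    apply qp_inj (M := M)
    have hl : ∀ z : Fin (d + 1) → ℕ, 0 < (qp d M z).leadingCoeff := by
      intro z
      rw [leadingCoeff, qp_natDegree hd, qp_coeff_last hd]
      omega
    apply eq_of_root (qp_irred hd x (hGp x hx).2) (qp_irred hd y (hGp y hy).2) _ _ (hl x) (hl y)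
      (hf x hx).2
    · rw [hxy]; exact (hf y hy).2
    · rw [qp_natDegree hd]; omega
    · rw [qp_natDegree hd]; omega
  have hsub : f '' (G : Set (Fin (d + 1) → ℕ)) ⊆ XSet d H prime := by
    rintro _ ⟨x, hx, rfl⟩
    have hx := Finset.mem_coe.1 hx
    have ha : f x ∈ algSet d H :=
      ⟨qp d M x, qp_irred hd x (hGp x hx).2, qp_natDegree hd x,
        qp_height hMH x (hGp x hx).1, (hf x hx).2⟩
    cases prime
    · simpa [XSet] using ha
    · simp only [XSet, if_true]
      exact ⟨ha, (hf x hx).1⟩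
  have hc := Set.ncard_le_ncard hsub (XSet_finite d H prime)
  rw [hinj.ncard_image, Set.ncard_coe_finset] at hc
  have hc' : (G.card : ℝ) ≤ (XSet d H prime).ncard := by exact_mod_cast hc
  refine le_trans ?_ (hG.trans hc')
  have hHM : (H : ℝ) ≤ 12 * M := by exact_mod_cast (by omega : H ≤ 12 * M)
  calc (1 / (2 * 12 ^ (d + 1)) : ℝ) * H ^ (d + 1)
      ≤ (1 / (2 * 12 ^ (d + 1)) : ℝ) * (12 * M) ^ (d + 1) := by gcongr
    _ = _ := by rw [mul_pow]; field_simp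

lemma theta_facts {Ψ : ℝ → ℝ} (hΨ : IsApproxFun Ψ) {Q₁ Q₂ : ℕ} (h1 : 1 ≤ Q₁) (h2 : Q₁ < Q₂) :
    0 < Theta Ψ Q₁ Q₂ ∧ ∀ q, Q₁ ≤ q → q < Q₂ → Theta Ψ Q₁ Q₂ ≤ 2 * Ψ q / q := by
  have hfin : ((fun q : ℕ => 2 * Ψ q / q) '' {q : ℕ | Q₁ ≤ q ∧ q < Q₂}).Finite :=
    (Set.finite_Ico Q₁ Q₂).image _
  have hne : ((fun q : ℕ => 2 * Ψ q / q) '' {q : ℕ | Q₁ ≤ q ∧ q < Q₂}).Nonempty :=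
    ⟨_, Q₁, ⟨le_rfl, h2⟩, rfl⟩
  constructor
  · obtain ⟨q, hq, he⟩ := hne.csInf_mem hfin
    unfold Theta
    rw [← he]
    have hq0 : (0 : ℝ) < q := by
      have : 1 ≤ q := h1.trans hq.1
      exact_mod_cast this
    have := hΨ.1 q hq0
    positivity
  · intro q hq hq'
    exact csInf_le hfin.bddBelow ⟨q, ⟨hq, hq'⟩, rfl⟩

/-- Every point of `J` lies in a subinterval of `J` of length at least `Θ/2`. -/
lemma J_interval {Ψ : ℝ → ℝ} (hΨ : IsApproxFun Ψ) {Q₁ Q₂ : ℕ} (h1 : 1 ≤ Q₁) (h2 : Q₁ < Q₂)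
    (hT : Theta Ψ Q₁ Q₂ < 1) {x : ℝ} (hx : x ∈ JPsi Ψ Q₁ Q₂) :
    ∃ a b, a ≤ x ∧ x ≤ b ∧ 0 ≤ a ∧ b ≤ 1 ∧ Theta Ψ Q₁ Q₂ / 2 ≤ b - a ∧
      Icc a b ⊆ JPsi Ψ Q₁ Q₂ := by
  obtain ⟨hT0, hTq⟩ := theta_facts hΨ h1 h2
  simp only [JPsi, Set.mem_iUnion, exists_prop] at hx
  obtain ⟨q, hq, p, hp, hx, hx01⟩ := hx
  have hq' := Finset.mem_Ico.1 hq
  have hp' : p ≤ q := by have := Finset.mem_range.1 hp; omega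
  have hth := hTq q hq'.1 hq'.2
  have hq0 : (0 : ℝ) < q := by
    have : 1 ≤ q := h1.trans hq'.1
    exact_mod_cast this
  have hc0 : (0 : ℝ) ≤ (p : ℝ) / q := by positivity
  have hc1 : (p : ℝ) / q ≤ 1 := by
    rw [div_le_one hq0]; exact_mod_cast hp'
  rw [mul_div_assoc] at hth
  refine ⟨max ((p : ℝ) / q - Ψ q / q) 0, min ((p : ℝ) / q + Ψ q / q) 1, max_le hx.1 hx01.1,
    le_min hx.2 hx01.2, le_max_right _ _, min_le_right _ _, ?_, ?_⟩
  · rcases max_cases ((p : ℝ) / q - Ψ q / q) 0 with ⟨e, _⟩ | ⟨e, _⟩ <;>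
      rcases min_cases ((p : ℝ) / q + Ψ q / q) 1 with ⟨e', _⟩ | ⟨e', _⟩ <;>
      rw [e, e'] <;> linarith
  · intro y hy
    simp only [JPsi, Set.mem_iUnion, exists_prop]
    exact ⟨q, hq, p, hp, ⟨(le_max_left _ _).trans hy.1, hy.2.trans (min_le_left _ _)⟩,
      (le_max_right _ _).trans hy.1, hy.2.trans (min_le_right _ _)⟩

/-- Cover of a thick set by grid cells. -/
lemma cover {J : Set ℝ} {θ : ℝ} (hθ0 : 0 < θ) (hθ1 : θ < 1)
    (hJ1 : J ⊆ Icc 0 1)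
    (hJ : ∀ x ∈ J, ∃ a b, a ≤ x ∧ x ≤ b ∧ 0 ≤ a ∧ b ≤ 1 ∧ θ / 2 ≤ b - a ∧ Icc a b ⊆ J) :
    ∃ (n : ℕ) (G : Finset ℕ), 0 < n ∧ θ / 16 ≤ 1 / (n : ℝ) ∧
      (∀ k ∈ G, k < n) ∧
      (G.card : ℝ) * (1 / n) ≤ 2 * (volume J).toReal ∧
      ∀ x ∈ J, ∃ k ∈ G, x ∈ Icc ((k : ℝ) / n) ((k + 1 : ℝ) / n) := by
  classical
  set n : ℕ := ⌈8 / θ⌉₊ with hn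
  have hn1 : 8 / θ ≤ n := Nat.le_ceil _
  have h8 : 8 ≤ 8 / θ := by rw [le_div_iff₀ hθ0]; linarith
  have hn0 : (0 : ℝ) < n := by linarith
  have hn0' : 0 < n := by exact_mod_cast hn0
  have hn2 : (n : ℝ) ≤ 16 / θ := by
    have := Nat.ceil_lt_add_one (by positivity : 0 ≤ 8 / θ)
    have e : 16 / θ = 8 / θ + 8 / θ := by ring
    linarith
  have hh : 4 * (1 / (n : ℝ)) ≤ θ / 2 := by
    rw [div_le_iff₀ hθ0] at hn1
    rw [mul_one_div, div_le_div_iff₀ hn0 (by norm_num)]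
    linarith
  set cell : ℕ → Set ℝ := fun k => Icc ((k : ℝ) / n) ((k + 1 : ℝ) / n) with hcell
  set G : Finset ℕ := (Finset.range n).filter (fun k => (cell k ∩ J).Nonempty) with hG
  set F : Finset ℕ := (Finset.range n).filter (fun k => cell k ⊆ J) with hF
  refine ⟨n, G, hn0', ?_, ?_, ?_, ?_⟩
  · rw [div_le_div_iff₀ (by norm_num) hn0]
    rw [le_div_iff₀ hθ0] at hn2
    linarith
  · intro k hk
    exact Finset.mem_range.1 (Finset.mem_filter.1 hk).1
  · have hGF : G ⊆ F.image (fun k => k + 1) ∪ F.image (fun k => k - 1) := by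
      intro k hk
      obtain ⟨hkn, x, hxc, hxJ⟩ := Finset.mem_filter.1 hk
      have hkn := Finset.mem_range.1 hkn
      obtain ⟨a, b, hax, hxb, ha0, hb1, hab, hsub⟩ := hJ x hxJ
      obtain ⟨hx1, hx2⟩ := hxc
      have e1 : ((k : ℝ) + 1) / n = k / n + 1 / n := by ring
      rw [e1] at hx2
      rw [Finset.mem_union, Finset.mem_image, Finset.mem_image]
      by_cases hc : x + 2 * (1 / n) ≤ b
      · right
        have hlt : (((k + 1 : ℕ) : ℝ) + 1) / n ≤ b := by
          have : (((k + 1 : ℕ) : ℝ) + 1) / n = k / n + 2 * (1 / n) := by push_cast; ring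
          rw [this]; linarith
        refine ⟨k + 1, Finset.mem_filter.2 ⟨Finset.mem_range.2 ?_, ?_⟩, by omega⟩
        · have : (((k + 1 : ℕ) : ℝ) + 1) / n ≤ 1 := hlt.trans hb1
          rw [div_le_one hn0] at this
          have : k + 1 + 1 ≤ n := by exact_mod_cast this
          omega
        · refine subset_trans (Icc_subset_Icc ?_ hlt) hsub
          push_cast
          rw [e1]; linarith
      · left
        push Not at hc
        have hlow : a ≤ k / n - 1 / n := by linarith
        have hk1 : 1 ≤ k := by
          by_contra h0
          have : k = 0 := by omega
          rw [this] at hlow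
          have : 0 < 1 / (n : ℝ) := by positivity
          simp only [Nat.cast_zero, zero_div, zero_sub] at hlow
          linarith
        have e2 : ((k - 1 : ℕ) : ℝ) = k - 1 := by push_cast [hk1]; ring
        refine ⟨k - 1, Finset.mem_filter.2 ⟨Finset.mem_range.2 (by omega), ?_⟩, by omega⟩
        refine subset_trans (Icc_subset_Icc ?_ ?_) hsub
        · rw [e2, sub_div]; exact hlow
        · rw [e2, sub_add_cancel]; exact hx1.trans hxb
    have hGc : G.card ≤ 2 * F.card := by
      refine (Finset.card_le_card hGF).trans ((Finset.card_union_le _ _).trans ?_)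
      have h1 := Finset.card_image_le (s := F) (f := fun k => k + 1)
      have h2 := Finset.card_image_le (s := F) (f := fun k => k - 1)
      omega
    have hvol : (F.card : ℝ) * (1 / n) ≤ (volume J).toReal := by
      have hsub : (⋃ k ∈ F, Ico ((k : ℝ) / n) ((k + 1 : ℝ) / n)) ⊆ J := by
        intro y hy
        simp only [Set.mem_iUnion, exists_prop] at hy
        obtain ⟨k, hk, hy⟩ := hy
        exact (Finset.mem_filter.1 hk).2 (Ico_subset_Icc_self hy)
      have hfin : volume J ≠ ⊤ := by
        refine ne_top_of_le_ne_top ?_ (measure_mono hJ1)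
        simp
      have hm : volume (⋃ k ∈ F, Ico ((k : ℝ) / n) ((k + 1 : ℝ) / n)) =
          ∑ k ∈ F, volume (Ico ((k : ℝ) / n) ((k + 1 : ℝ) / n)) := by
        apply measure_biUnion_finset
        · intro i _ j _ hij
          change Disjoint (Ico ((i : ℝ) / n) ((i + 1 : ℝ) / n)) (Ico ((j : ℝ) / n) ((j + 1 : ℝ) / n))
          rw [Set.disjoint_left]
          intro y hi hj
          apply hij
          have a1 := hi.1
          have a2 := hi.2
          have b1 := hj.1
          have b2 := hj.2
          rw [div_le_iff₀ hn0] at a1 b1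
          rw [lt_div_iff₀ hn0] at a2 b2
          have c1 : (i : ℝ) < j + 1 := by linarith
          have c2 : (j : ℝ) < i + 1 := by linarith
          have c1 : i < j + 1 := by exact_mod_cast c1
          have c2 : j < i + 1 := by exact_mod_cast c2
          omega
        · intro i _; exact measurableSet_Ico
      have hle := ENNReal.toReal_mono hfin (measure_mono hsub (μ := volume))
      rw [hm, ENNReal.toReal_sum (by intro k _; simp)] at hle
      refine le_trans (le_of_eq ?_) hle
      rw [← nsmul_eq_mul, ← Finset.sum_const]
      apply Finset.sum_congr rfl
      intro k _
      have e1 : ((k : ℝ) + 1) / n - k / n = 1 / n := by ring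
      rw [Real.volume_Ico, e1, ENNReal.toReal_ofReal (by positivity)]
    have hGc' : (G.card : ℝ) ≤ 2 * F.card := by exact_mod_cast hGc
    calc (G.card : ℝ) * (1 / n) ≤ (2 * F.card) * (1 / n) := by gcongr
      _ = 2 * (F.card * (1 / n)) := by ring
      _ ≤ _ := by gcongr
  · intro x hx
    have hx01 := hJ1 hx
    suffices h : ∃ k, k < n ∧ x ∈ cell k by
      obtain ⟨k, hk, hxk⟩ := h
      exact ⟨k, Finset.mem_filter.2 ⟨Finset.mem_range.2 hk, x, hxk, hx⟩, hxk⟩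
    rcases hx01.2.lt_or_eq with hlt | heq
    · refine ⟨⌊x * n⌋₊, ?_, ?_, ?_⟩
      · rw [Nat.floor_lt (mul_nonneg hx01.1 hn0.le)]
        nlinarith
      · rw [div_le_iff₀ hn0]
        exact Nat.floor_le (mul_nonneg hx01.1 hn0.le)
      · rw [le_div_iff₀ hn0]
        exact (Nat.lt_floor_add_one _).le
    · refine ⟨n - 1, by omega, ?_⟩
      have e2 : ((n - 1 : ℕ) : ℝ) = n - 1 := by push_cast [hn0']; ring
      rw [hcell, heq]
      simp only
      rw [e2, sub_add_cancel, div_self hn0.ne', sub_div, div_self hn0.ne']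
      have : 0 < 1 / (n : ℝ) := by positivity
      exact ⟨by linarith, le_rfl⟩

lemma JPsi_sub (Ψ : ℝ → ℝ) (Q₁ Q₂ : ℕ) : JPsi Ψ Q₁ Q₂ ⊆ Icc 0 1 := by
  intro x hx
  simp only [JPsi, Set.mem_iUnion, exists_prop] at hx
  obtain ⟨q, hq, p, hp, hx, hx01⟩ := hx
  exact hx01

lemma main_count {d H : ℕ} (hd : 2 ≤ d) (prime : Bool) (hH : 1 ≤ H)
    {J : Set ℝ} {θ : ℝ} (hθ0 : 0 < θ) (hθ1 : θ < 1)
    (hJ1 : J ⊆ Icc 0 1)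
    (hJ : ∀ x ∈ J, ∃ a b, a ≤ x ∧ x ≤ b ∧ 0 ≤ a ∧ b ≤ 1 ∧ θ / 2 ≤ b - a ∧ Icc a b ⊆ J) :
    (countModOne (XSet d H prime) J : ℝ) ≤
      24 * KK d * H ^ (d + 1) * (volume J).toReal * (1 + 16 * ee prime H / θ) := by
  classical
  obtain ⟨n, G, hn, hnθ, hGn, hGc, hcov⟩ := cover hθ0 hθ1 hJ1 hJ
  have hn0 : (0 : ℝ) < n := by exact_mod_cast hn
  have hf : ∀ k : ℕ, {α : ℝ | α ∈ XSet d H prime ∧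
      Int.fract α ∈ Icc ((k : ℝ) / n) ((k + 1 : ℝ) / n)}.Finite :=
    fun k => (XSet_finite d H prime).subset (fun x hx => hx.1)
  have hsub : {α : ℝ | α ∈ XSet d H prime ∧ Int.fract α ∈ J} ⊆
      ((G.biUnion fun k => (hf k).toFinset : Finset ℝ) : Set ℝ) := by
    rintro α ⟨hα, hαJ⟩
    obtain ⟨k, hk, hk'⟩ := hcov _ hαJ
    rw [Finset.mem_coe, Finset.mem_biUnion]
    refine ⟨k, hk, ?_⟩
    rw [Set.Finite.mem_toFinset]
    exact ⟨hα, hk'⟩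
  have hK : 0 < 12 * KK d * (H : ℝ) ^ (d + 1) := by
    have := KK_pos hd
    have : (0 : ℝ) < H := by exact_mod_cast hH
    positivity
  have hee : 0 ≤ ee prime H := by
    unfold ee; split_ifs <;> positivity
  have h1 : countModOne (XSet d H prime) J ≤ ∑ k ∈ G, (hf k).toFinset.card := by
    unfold countModOne
    refine (Set.ncard_le_ncard hsub (Finset.finite_toSet _)).trans ?_
    rw [Set.ncard_coe_finset]
    exact Finset.card_biUnion_le
  have h2 : (countModOne (XSet d H prime) J : ℝ) ≤ ∑ k ∈ G, ((hf k).toFinset.card : ℝ) := by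
    exact_mod_cast h1
  have h3 : ∑ k ∈ G, ((hf k).toFinset.card : ℝ) ≤
      ∑ k ∈ G, 12 * KK d * (H : ℝ) ^ (d + 1) * (1 / n + ee prime H) := by
    apply Finset.sum_le_sum
    intro k hk
    rw [← Set.ncard_eq_toFinset_card _ (hf k)]
    have hkn : (k : ℝ) + 1 ≤ n := by exact_mod_cast hGn k hk
    have := count_both hd prime hH (u := (k : ℝ) / n) (v := (k + 1 : ℝ) / n) (by positivity)
      (by gcongr; linarith) (by rw [div_le_one hn0]; exact hkn)
    rw [show ((k : ℝ) + 1) / n - k / n = 1 / n by ring] at this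
    exact this
  rw [Finset.sum_const, nsmul_eq_mul] at h3
  have h4 : 1 / (n : ℝ) + ee prime H ≤ 1 / n * (1 + 16 * ee prime H / θ) := by
    have : ee prime H ≤ 1 / n * (16 * ee prime H / θ) := by
      calc ee prime H = (θ / 16) * (16 * ee prime H / θ) := by field_simp
        _ ≤ _ := by gcongr
    linarith
  calc _ ≤ _ := h2
    _ ≤ _ := h3
    _ ≤ (G.card : ℝ) * (12 * KK d * (H : ℝ) ^ (d + 1) *
        (1 / n * (1 + 16 * ee prime H / θ))) := by gcongr
    _ = (G.card * (1 / n)) * (12 * KK d * (H : ℝ) ^ (d + 1) * (1 + 16 * ee prime H / θ)) := by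
      ring
    _ ≤ (2 * (volume J).toReal) *
        (12 * KK d * (H : ℝ) ^ (d + 1) * (1 + 16 * ee prime H / θ)) := by gcongr
    _ = _ := by ring

end AlgCount

theorem stmt0 (d : ℕ) (hd : 2 ≤ d) (prime : Bool) :
    ∃ (H₀ : ℕ) (Cerr C₁ C₂ : ℝ), 2 ≤ H₀ ∧ 0 < Cerr ∧ 0 < C₁ ∧ 0 < C₂ ∧
      ∀ Ψ : ℝ → ℝ, IsApproxFun Ψ →
      ∀ Q₁ Q₂ : ℕ, 1 ≤ Q₁ → Q₁ < Q₂ →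
      ∀ δ : ℝ, δ ∈ Set.Ioo (0 : ℝ) 1 →
      ∀ H : ℕ, H₀ ≤ H →
      Theta Ψ Q₁ Q₂ < C₁ * δ →
      (countModOne (XSet d H prime) (JPsi Ψ Q₁ Q₂) : ℝ) /
          (Set.ncard (XSet d H prime) : ℝ) ≤
        C₂ * (volume (JPsi Ψ Q₁ Q₂)).toReal * (1 + Theta Ψ Q₁ Q₂) *
          (1 / (1 - δ) + ErrTerm prime Cerr d H / Theta Ψ Q₁ Q₂) := by
  refine ⟨72, 16, 1, 24 * AlgCount.KK d * (2 * 12 ^ (d + 1)), by norm_num, by norm_num,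
    by norm_num, by have := AlgCount.KK_pos hd; positivity, ?_⟩
  intro Ψ hΨ Q₁ Q₂ h1 h2 δ hδ H hH hθ
  have hθ1 : Theta Ψ Q₁ Q₂ < 1 := by linarith [hδ.2]
  have hθ0 := (AlgCount.theta_facts hΨ h1 h2).1
  have hc := AlgCount.main_count (d := d) (H := H) hd prime (by omega) hθ0 hθ1
    (AlgCount.JPsi_sub Ψ Q₁ Q₂) (fun x hx => AlgCount.J_interval hΨ h1 h2 hθ1 hx)
  have hl := AlgCount.lower (d := d) (H := H) hd prime hH
  have he := AlgCount.ErrTerm_ge (d := d) (H := H) prime (by omega)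
  have hKp := AlgCount.KK_pos hd
  have hHp : (0 : ℝ) < H := by exact_mod_cast (by omega : 0 < H)
  have hee : 0 ≤ AlgCount.ee prime H := by
    unfold AlgCount.ee; split_ifs <;> positivity
  set θ := Theta Ψ Q₁ Q₂
  set V := (volume (JPsi Ψ Q₁ Q₂)).toReal with hV
  have hV0 : 0 ≤ V := ENNReal.toReal_nonneg
  have hpos : (0 : ℝ) < 1 / (2 * 12 ^ (d + 1)) * (H : ℝ) ^ (d + 1) := by positivity
  have hδ1 : 1 ≤ 1 / (1 - δ) := by
    rw [le_div_iff₀ (by linarith [hδ.2])]; linarith [hδ.1]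
  calc _ ≤ (24 * AlgCount.KK d * H ^ (d + 1) * V * (1 + 16 * AlgCount.ee prime H / θ)) /
        (1 / (2 * 12 ^ (d + 1)) * (H : ℝ) ^ (d + 1)) := by
        apply div_le_div₀ (by positivity) hc hpos hl
    _ = 24 * AlgCount.KK d * (2 * 12 ^ (d + 1)) * V * 1 *
        (1 + 16 * AlgCount.ee prime H / θ) := by field_simp
    _ ≤ _ := by
      gcongr
      linarith
end
end

section
/- Fix an integer d ≥ 2 and let 𝕏_d(H) denote either 𝔸_d(H) or 𝔸'_d(H); for a set J ⊂ [0,1] write #(J ∩ 𝕏_d(H)) for the number of α ∈ 𝕏_d(H) whose reduction modulo 1 lies in J. If len*(J̃_Ψ(Q₁,Q₂)) = 0, then J_Ψ(Q₁,Q₂) = [0,1] and in particular #(J_Ψ(Q₁,Q₂) ∩ 𝕏_d(H))/#𝕏_d(H) = 1. Moreover, there exist constants H₀(d) ≥ 2 and C(d), C'(d), C₁(𝕏_d), C₂(𝕏_d) > 0 such that, setting E(H) = C(d)·√((log H)^{l(d)}/H) when 𝕏_d = 𝔸_d and E(H) = C'(d)·(log H)^{l(d)}/H when 𝕏_d = 𝔸'_d,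 the following holds for every approximation function Ψ, all integers Q₂ > Q₁ ≥ 1, every δ ∈ (0,1) and every integer H ≥ H₀(d): if 0 < len*(J̃_Ψ(Q₁,Q₂)) < C₁(𝕏_d)·δ, then 1 − #(J_Ψ(Q₁,Q₂) ∩ 𝕏_d(H))/#𝕏_d(H) ≤ C₂(𝕏_d)·|J̃_Ψ(Q₁,Q₂)|·(1 + len*(J̃_Ψ(Q₁,Q₂)))·(1/(1−δ) + E(H)/len*(J̃_Ψ(Q₁,Q₂))), where |·| denotes Lebesgue measure. -/
open MeasureTheory Set

noncomputable section

/-- `J̃_Ψ(Q₁,Q₂)`: the closure of the complement of `J_Ψ(Q₁,Q₂)` in `[0,1]`. -/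
def JTilde (Ψ : ℝ → ℝ) (Q₁ Q₂ : ℕ) : Set ℝ :=
  closure (Set.Icc 0 1 \ JPsi Ψ Q₁ Q₂)

/-- `len*(S)`: the minimal length of the connected components of `S`. -/
def lenStar (S : Set ℝ) : ℝ :=
  sInf ((fun x => (volume (connectedComponentIn S x)).toReal) '' S)

/-- the integer polynomial with given coefficients -/
def polyOf {d : ℕ} (c : Fin (d + 1) → ℤ) : Polynomial ℤ :=
  ∑ i : Fin (d + 1), Polynomial.C (c i) * Polynomial.X ^ (i : ℕ)

lemma polyOf_coeff {d : ℕ} (c : Fin (d + 1) → ℤ) (i : Fin (d + 1)) :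
    (polyOf c).coeff i = c i := by
  unfold polyOf
  rw [Polynomial.finsetSum_coeff, Finset.sum_eq_single i]
  · simp
  · intro j _ hj
    rw [Polynomial.coeff_C_mul, Polynomial.coeff_X_pow, if_neg, mul_zero]
    intro h; exact hj (Fin.ext h.symm)
  · simp

lemma polyOf_coeff_gt {d : ℕ} (c : Fin (d + 1) → ℤ) (k : ℕ) (hk : d < k) :
    (polyOf c).coeff k = 0 := by
  unfold polyOf
  rw [Polynomial.finsetSum_coeff]
  refine Finset.sum_eq_zero fun j _ => ?_
  rw [Polynomial.coeff_C_mul, Polynomial.coeff_X_pow, if_neg, mul_zero]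
  omega

lemma polyOf_natDegree_le {d : ℕ} (c : Fin (d + 1) → ℤ) : (polyOf c).natDegree ≤ d :=
  Polynomial.natDegree_le_iff_coeff_eq_zero.2 fun k hk => polyOf_coeff_gt c k hk

lemma polyOf_aeval {d : ℕ} (c : Fin (d + 1) → ℤ) (x : ℝ) :
    Polynomial.aeval x (polyOf c) = ∑ i : Fin (d + 1), (c i : ℝ) * x ^ (i : ℕ) := by
  unfold polyOf
  simp

lemma polyOf_ne_zero {d : ℕ} {c : Fin (d + 1) → ℤ} (hc : c ≠ 0) : polyOf c ≠ 0 := by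
  intro h
  apply hc
  funext i
  rw [← polyOf_coeff c i, h]; simp

/-- roots of nonzero integer polynomials of degree at most d and height at most H -/
def rootSet (d H : ℕ) : Set ℝ :=
  {α : ℝ | ∃ c : Fin (d + 1) → ℤ, c ≠ 0 ∧ (∀ i, |c i| ≤ (H : ℤ)) ∧
    ∑ i : Fin (d + 1), (c i : ℝ) * α ^ (i : ℕ) = 0}

lemma algSet_subset (d H : ℕ) : algSet d H ⊆ rootSet d H := by
  rintro α ⟨P, hirr, hdeg, hco, h0⟩
  refine ⟨fun i => P.coeff i, ?_, ?_, ?_⟩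
  · intro h
    have h1 := congrFun h (Fin.last d)
    simp only [Fin.val_last, Pi.zero_apply] at h1
    rw [← hdeg, Polynomial.coeff_natDegree, Polynomial.leadingCoeff_eq_zero] at h1
    exact hirr.ne_zero h1
  · intro i
    have := hco i
    exact_mod_cast this
  · rw [Polynomial.aeval_eq_sum_range, hdeg] at h0
    rw [← h0, Finset.sum_range]
    simp

lemma rootSet_inv {d H : ℕ} {α : ℝ} (h : α ∈ rootSet d H) (h0 : α ≠ 0) :
    α⁻¹ ∈ rootSet d H := by
  obtain ⟨c, hc, hH, hs⟩ := h
  refine ⟨fun i => c i.rev, ?_, fun i => hH _, ?_⟩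
  · intro h
    apply hc
    funext i
    have := congrFun h i.rev
    simpa using this
  · have : ∑ i : Fin (d + 1), (c i.rev : ℝ) * α⁻¹ ^ (i : ℕ)
        = ∑ i : Fin (d + 1), (c i : ℝ) * α⁻¹ ^ (i.rev : ℕ) := by
      rw [← Equiv.sum_comp Fin.revPerm]
      simp
    rw [this]
    have h2 : ∀ i : Fin (d + 1), (c i : ℝ) * α⁻¹ ^ (i.rev : ℕ)
        = (α⁻¹) ^ d * ((c i : ℝ) * α ^ (i : ℕ)) := by
      intro i
      have hi : (i.rev : ℕ) + i = d := by rw [Fin.val_rev]; omega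
      have : α⁻¹ ^ d = α⁻¹ ^ (i.rev : ℕ) * α⁻¹ ^ (i : ℕ) := by rw [← pow_add, hi]
      rw [this, inv_pow α (i : ℕ)]
      field_simp
    simp_rw [h2]
    rw [← Finset.mul_sum, hs, mul_zero]

lemma pow_diff_le (x a : ℝ) (hx : |x| ≤ 1) (ha : |a| ≤ 1) (k : ℕ) :
    |x ^ k - a ^ k| ≤ k * |x - a| := by
  induction k with
  | zero => simp
  | succ k ih =>
    have : x ^ (k + 1) - a ^ (k + 1) = x * (x ^ k - a ^ k) + a ^ k * (x - a) := by ring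
    rw [this]
    refine (abs_add_le _ _).trans ?_
    rw [abs_mul, abs_mul, abs_pow]
    have h1 : |x| * |x ^ k - a ^ k| ≤ 1 * (k * |x - a|) :=
      mul_le_mul hx ih (abs_nonneg _) zero_le_one
    have h2 : |a| ^ k * |x - a| ≤ 1 * |x - a| :=
      mul_le_mul_of_nonneg_right (pow_le_one₀ (abs_nonneg _) ha) (abs_nonneg _)
    push_cast
    linarith

/-- coefficient vectors of height at most H -/
def coefBox (n H : ℕ) : Finset (Fin n → ℤ) :=
  Fintype.piFinset fun _ => Finset.Icc (-(H : ℤ)) H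

lemma mem_coefBox {n H : ℕ} {c : Fin n → ℤ} : c ∈ coefBox n H ↔ ∀ i, |c i| ≤ (H : ℤ) := by
  simp [coefBox, abs_le]

lemma card_coefBox (n H : ℕ) : (coefBox n H).card = (2 * H + 1) ^ n := by
  simp only [coefBox, Fintype.card_piFinset, Int.card_Icc, Finset.prod_const, Finset.card_univ,
    Fintype.card_fin]
  congr 1
  omega

lemma int_count (s D : ℝ) (hD : 0 ≤ D) (F : Finset ℤ) (hF : ∀ z ∈ F, |(z : ℝ) + s| ≤ D) :
    F.card ≤ ⌊2 * D⌋₊ + 1 := by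
  have hsub : F ⊆ Finset.Icc ⌈-s - D⌉ ⌊-s + D⌋ := by
    intro z hz
    have := abs_le.1 (hF z hz)
    rw [Finset.mem_Icc, Int.ceil_le, Int.le_floor]
    constructor <;> linarith
  refine (Finset.card_le_card hsub).trans ?_
  rw [Int.card_Icc]
  have h1 : ((⌊-s + D⌋ - ⌈-s - D⌉ : ℤ) : ℝ) ≤ 2 * D := by
    have := Int.floor_le (-s + D)
    have := Int.le_ceil (-s - D)
    push_cast
    linarith
  have h2 : ⌊-s + D⌋ - ⌈-s - D⌉ ≤ ⌊2 * D⌋ := Int.le_floor.2 h1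
  have h3 : ((⌊2 * D⌋₊ : ℕ) : ℤ) = ⌊2 * D⌋ := Int.natCast_floor_eq_floor (by linarith)
  omega

open Classical in
lemma card_polys (d H : ℕ) (a b : ℝ) (ha : -1 ≤ a) (hb : b ≤ 1) (hab : a ≤ b) :
    ((coefBox (d + 1) H).filter
      (fun c => ∃ x ∈ Set.Icc a b, ∑ i : Fin (d + 1), (c i : ℝ) * x ^ (i : ℕ) = 0)).card
      ≤ (⌊2 * (((d + 1) * d * H : ℕ) * (b - a))⌋₊ + 1) * (2 * H + 1) ^ d := by
  set S := (coefBox (d + 1) H).filter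
      (fun c => ∃ x ∈ Set.Icc a b, ∑ i : Fin (d + 1), (c i : ℝ) * x ^ (i : ℕ) = 0) with hS
  set D : ℝ := ((d + 1) * d * H : ℕ) * (b - a) with hDdef
  have hD : 0 ≤ D := mul_nonneg (Nat.cast_nonneg _) (by linarith)
  have key := Finset.card_le_mul_card_image (f := fun c : Fin (d + 1) → ℤ => Fin.tail c) S
    (⌊2 * D⌋₊ + 1) ?_
  · refine key.trans (Nat.mul_le_mul_left _ ?_)
    rw [← card_coefBox d H]
    refine Finset.card_le_card ?_
    intro t ht
    obtain ⟨c, hc, rfl⟩ := Finset.mem_image.1 ht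
    have := mem_coefBox.1 (Finset.mem_filter.1 hc).1
    exact mem_coefBox.2 fun i => this i.succ
  · intro t ht
    have hinj : Set.InjOn (fun c : Fin (d + 1) → ℤ => c 0) (S.filter fun c => Fin.tail c = t) := by
      intro c hc c' hc' h
      have h1 := (Finset.mem_filter.1 hc).2
      have h2 := (Finset.mem_filter.1 hc').2
      rw [← Fin.cons_self_tail c, ← Fin.cons_self_tail c', h1, h2]
      simp only at h
      rw [h]
    rw [← Finset.card_image_of_injOn hinj]
    refine int_count (∑ i : Fin d, (t i : ℝ) * a ^ ((i : ℕ) + 1)) D hD _ ?_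
    intro z hz
    obtain ⟨c, hc, rfl⟩ := Finset.mem_image.1 hz
    obtain ⟨hcS, rfl⟩ := Finset.mem_filter.1 hc
    obtain ⟨hbox, x, hx, h0⟩ := Finset.mem_filter.1 hcS
    have hbox := mem_coefBox.1 hbox
    have e1 : (c 0 : ℝ) + ∑ i : Fin d, (Fin.tail c i : ℝ) * a ^ ((i : ℕ) + 1)
        = ∑ i : Fin (d + 1), (c i : ℝ) * a ^ (i : ℕ) := by
      rw [Fin.sum_univ_succ]
      simp [Fin.tail]
    rw [e1]
    have e2 : ∑ i : Fin (d + 1), (c i : ℝ) * a ^ (i : ℕ)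
        = ∑ i : Fin (d + 1), (c i : ℝ) * (a ^ (i : ℕ) - x ^ (i : ℕ)) := by
      simp_rw [mul_sub]
      rw [Finset.sum_sub_distrib, h0, sub_zero]
    rw [e2]
    refine (Finset.abs_sum_le_sum_abs _ _).trans ?_
    have e3 : ∀ i ∈ (Finset.univ : Finset (Fin (d + 1))),
        |(c i : ℝ) * (a ^ (i : ℕ) - x ^ (i : ℕ))| ≤ H * (d * (b - a)) := by
      intro i _
      rw [abs_mul]
      have h1 : |(c i : ℝ)| ≤ H := by exact_mod_cast hbox i
      have h2 := pow_diff_le a x (abs_le.2 ⟨ha, by linarith⟩)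
        (abs_le.2 ⟨by linarith [hx.1], by linarith [hx.2]⟩) i
      have h3 : |a - x| ≤ b - a := by
        rw [abs_le]; constructor <;> linarith [hx.1, hx.2]
      have h4 : ((i : ℕ) : ℝ) ≤ d := by exact_mod_cast Nat.lt_succ_iff.1 i.2
      exact mul_le_mul h1 (h2.trans (mul_le_mul h4 h3 (abs_nonneg _) (Nat.cast_nonneg _)))
        (abs_nonneg _) (Nat.cast_nonneg _)
    refine (Finset.sum_le_card_nsmul _ _ _ e3).trans ?_
    rw [hDdef]
    simp
    apply le_of_eq
    ring

open Classical in
lemma rootSet_Icc_aux (d H : ℕ) (a b : ℝ) (ha : -1 ≤ a) (hb : b ≤ 1) (hab : a ≤ b) :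
    (rootSet d H ∩ Set.Icc a b).Finite ∧ (rootSet d H ∩ Set.Icc a b).ncard ≤
      ((⌊2 * (((d + 1) * d * H : ℕ) * (b - a))⌋₊ + 1) * (2 * H + 1) ^ d) * d := by
  set S := (coefBox (d + 1) H).filter
      (fun c => ∃ x ∈ Set.Icc a b, ∑ i : Fin (d + 1), (c i : ℝ) * x ^ (i : ℕ) = 0) with hS
  have hsub : rootSet d H ∩ Set.Icc a b ⊆
      ((S.biUnion fun c => ((polyOf c).aroots ℝ).toFinset : Finset ℝ) : Set ℝ) := by
    rintro α ⟨⟨c, hc, hH, h0⟩, hα⟩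
    simp only [Finset.coe_biUnion, Set.mem_iUnion, Finset.mem_coe]
    refine ⟨c, Finset.mem_filter.2 ⟨mem_coefBox.2 hH, α, hα, h0⟩, ?_⟩
    rw [Multiset.mem_toFinset, Polynomial.mem_aroots]
    exact ⟨polyOf_ne_zero hc, by rw [polyOf_aeval]; exact h0⟩
  refine ⟨(Finset.finite_toSet _).subset hsub, ?_⟩
  refine (Set.ncard_le_ncard hsub (Finset.finite_toSet _)).trans ?_
  rw [Set.ncard_coe_finset]
  refine (Finset.card_biUnion_le_card_mul _ _ d ?_).trans
    (Nat.mul_le_mul_right _ (card_polys d H a b ha hb hab))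
  intro c _
  refine (Multiset.toFinset_card_le _).trans ?_
  refine (Polynomial.card_roots' _).trans ?_
  exact Polynomial.natDegree_map_le.trans (polyOf_natDegree_le c)

/-- the constant in the upper bound -/
def CU (d : ℕ) : ℝ := d * 3 ^ d * (2 * ((d + 1) * d) + 1)

lemma CU_nonneg (d : ℕ) : 0 ≤ CU d := by unfold CU; positivity

lemma rootSet_Icc (d H : ℕ) (hH : 1 ≤ H) (a b : ℝ) (ha : -1 ≤ a) (hb : b ≤ 1) (hab : a ≤ b) :
    (rootSet d H ∩ Set.Icc a b).Finite ∧ ((rootSet d H ∩ Set.Icc a b).ncard : ℝ) ≤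
      CU d * H ^ (d + 1) * ((b - a) + 1 / H) := by
  obtain ⟨h1, h2⟩ := rootSet_Icc_aux d H a b ha hb hab
  refine ⟨h1, ?_⟩
  have hH' : (1 : ℝ) ≤ H := by exact_mod_cast hH
  have hba : 0 ≤ b - a := by linarith
  calc ((rootSet d H ∩ Set.Icc a b).ncard : ℝ)
      ≤ (((⌊2 * (((d + 1) * d * H : ℕ) * (b - a))⌋₊ + 1) * (2 * H + 1) ^ d) * d : ℕ) := by
        exact_mod_cast h2
    _ = (((⌊2 * (((d + 1) * d * H : ℕ) * (b - a))⌋₊ : ℝ) + 1) * (2 * (H : ℝ) + 1) ^ d) * d := by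
        push_cast; ring
    _ ≤ ((2 * (((d + 1) * d * H : ℕ) * (b - a)) + 1) * (3 * (H : ℝ)) ^ d) * d := by
        gcongr
        · exact Nat.floor_le (by positivity)
        · linarith
    _ ≤ ((2 * ((d + 1) * d) + 1) * H * ((b - a) + 1 / H) * (3 * (H : ℝ)) ^ d) * d := by
        gcongr
        push_cast
        have e : (2 * (((d : ℝ) + 1) * d) + 1) * H * ((b - a) + 1 / H)
          = 2 * ((d + 1) * d * H * (b - a)) + 1 + (H * (b - a) + 2 * ((d + 1) * d)) := by
          field_simp
          ring
        rw [e]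
        have : 0 ≤ H * (b - a) + 2 * (((d : ℝ) + 1) * d) := by positivity
        linarith
    _ = CU d * H ^ (d + 1) * ((b - a) + 1 / H) := by
        unfold CU
        rw [mul_pow]
        ring
lemma rootSet_of_inv (d H : ℕ) (hH : 1 ≤ H) (S : Set ℝ) (a b : ℝ) (ha : -1 ≤ a) (hb : b ≤ 1)
    (hab : a ≤ b) (hS : ∀ x ∈ S, x ≠ 0 ∧ x⁻¹ ∈ Set.Icc a b) :
    (rootSet d H ∩ S).Finite ∧ ((rootSet d H ∩ S).ncard : ℝ) ≤
      CU d * H ^ (d + 1) * ((b - a) + 1 / H) := by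
  obtain ⟨h1, h2⟩ := rootSet_Icc d H hH a b ha hb hab
  have hinj : Set.InjOn (fun x : ℝ => x⁻¹) (rootSet d H ∩ S) := inv_injective.injOn
  have hmaps : Set.MapsTo (fun x : ℝ => x⁻¹) (rootSet d H ∩ S) (rootSet d H ∩ Set.Icc a b) := by
    rintro x ⟨hx, hxS⟩
    exact ⟨rootSet_inv hx (hS x hxS).1, (hS x hxS).2⟩
  refine ⟨Set.Finite.of_injOn hmaps hinj h1, le_trans ?_ h2⟩
  exact_mod_cast Set.ncard_le_ncard_of_injOn _ hmaps hinj h1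

lemma rootSet_pos (d H : ℕ) (hH : 1 ≤ H) (u v m : ℝ) (hm : 1 ≤ m) (hu : m ≤ u) (huv : u ≤ v) :
    (rootSet d H ∩ Set.Icc u v).Finite ∧ ((rootSet d H ∩ Set.Icc u v).ncard : ℝ) ≤
      CU d * H ^ (d + 1) * ((v - u) / m ^ 2 + 1 / H) := by
  have hu0 : 0 < u := by linarith
  have hv0 : 0 < v := by linarith
  obtain ⟨h1, h2⟩ := rootSet_of_inv d H hH (Set.Icc u v) v⁻¹ u⁻¹
    (by have := inv_pos.2 hv0; linarith) (inv_le_one_of_one_le₀ (by linarith))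
    (inv_anti₀ hu0 huv) (by
      intro x hx
      have hx0 : 0 < x := lt_of_lt_of_le hu0 hx.1
      exact ⟨hx0.ne', inv_anti₀ hx0 hx.2, inv_anti₀ hu0 hx.1⟩)
  refine ⟨h1, h2.trans ?_⟩
  refine mul_le_mul_of_nonneg_left ?_ (mul_nonneg (CU_nonneg d) (by positivity))
  have : u⁻¹ - v⁻¹ = (v - u) / (u * v) := by field_simp
  rw [this]
  gcongr
  nlinarith

lemma rootSet_neg (d H : ℕ) (hH : 1 ≤ H) (u v m : ℝ) (hm : 1 ≤ m) (hv : v ≤ -m) (huv : u ≤ v) :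
    (rootSet d H ∩ Set.Icc u v).Finite ∧ ((rootSet d H ∩ Set.Icc u v).ncard : ℝ) ≤
      CU d * H ^ (d + 1) * ((v - u) / m ^ 2 + 1 / H) := by
  have hv0 : v < 0 := by linarith
  have hu0 : u < 0 := by linarith
  obtain ⟨h1, h2⟩ := rootSet_of_inv d H hH (Set.Icc u v) v⁻¹ u⁻¹
    (by
      have := inv_le_one_of_one_le₀ (a := -v) (by linarith)
      rw [inv_neg] at this
      linarith) (by have := inv_lt_zero.2 hu0; linarith)
    ((inv_le_inv_of_neg hv0 hu0).2 huv) (by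
      intro x hx
      have hx0 : x < 0 := lt_of_le_of_lt hx.2 hv0
      exact ⟨hx0.ne, (inv_le_inv_of_neg hv0 hx0).2 hx.2, (inv_le_inv_of_neg hx0 hu0).2 hx.1⟩)
  refine ⟨h1, h2.trans ?_⟩
  refine mul_le_mul_of_nonneg_left ?_ (mul_nonneg (CU_nonneg d) (by positivity))
  have : u⁻¹ - v⁻¹ = (v - u) / ((-u) * (-v)) := by
    have := hv0.ne
    have := hu0.ne
    field_simp
  rw [this]
  gcongr
  nlinarith

lemma rootSet_tail (d H : ℕ) (hH : 1 ≤ H) (N : ℕ) (hN : 1 ≤ N) :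
    ((rootSet d H ∩ Set.Ici (N : ℝ)).Finite ∧ ((rootSet d H ∩ Set.Ici (N : ℝ)).ncard : ℝ) ≤
      CU d * H ^ (d + 1) * (1 / N + 1 / H)) ∧
    ((rootSet d H ∩ Set.Iic (-N : ℝ)).Finite ∧ ((rootSet d H ∩ Set.Iic (-N : ℝ)).ncard : ℝ) ≤
      CU d * H ^ (d + 1) * (1 / N + 1 / H)) := by
  have hN' : (1 : ℝ) ≤ N := by exact_mod_cast hN
  have hN0 : (0 : ℝ) < N := by linarith
  have hi : (N : ℝ)⁻¹ ≤ 1 := inv_le_one_of_one_le₀ hN'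
  have hi0 : 0 < (N : ℝ)⁻¹ := inv_pos.2 hN0
  constructor
  · have := rootSet_of_inv d H hH (Set.Ici (N : ℝ)) 0 (N : ℝ)⁻¹ (by norm_num) hi hi0.le (by
      intro x hx
      have hx : (N : ℝ) ≤ x := hx
      have hx0 : 0 < x := by linarith
      exact ⟨hx0.ne', (inv_pos.2 hx0).le, inv_anti₀ hN0 hx⟩)
    simpa using this
  · have := rootSet_of_inv d H hH (Set.Iic (-N : ℝ)) (-(N : ℝ)⁻¹) 0 (by linarith) (by norm_num)
      (by linarith) (by
      intro x hx
      have hx : x ≤ -(N : ℝ) := hx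
      have hx0 : x < 0 := by linarith
      refine ⟨hx0.ne, ?_, (inv_lt_zero.2 hx0).le⟩
      rw [← inv_neg]
      exact (inv_le_inv_of_neg (by linarith) hx0).2 hx)
    simpa using this

lemma sum_inv_sq (N : ℕ) : ∑ m ∈ Finset.Icc 1 N, (1 : ℝ) / (m : ℝ) ^ 2 ≤ 2 := by
  have key : ∀ N : ℕ, ∑ m ∈ Finset.Icc 1 (N + 1), (1 : ℝ) / (m : ℝ) ^ 2 ≤ 2 - 1 / (N + 1) := by
    intro N
    induction N with
    | zero => norm_num
    | succ n ih =>
      rw [Finset.sum_Icc_succ_top (by omega)]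
      push_cast
      have hn : (0 : ℝ) ≤ n := Nat.cast_nonneg n
      have e : (1 : ℝ) / (n + 1) - 1 / (n + 1 + 1) - 1 / (n + 1 + 1) ^ 2
          = 1 / ((n + 1) * (n + 1 + 1) ^ 2) := by field_simp; ring
      have : (0 : ℝ) ≤ 1 / ((n + 1) * (n + 1 + 1) ^ 2) := by positivity
      linarith
  cases N with
  | zero => norm_num
  | succ n =>
    have h := key n
    have : (0 : ℝ) ≤ 1 / (n + 1) := by positivity
    linarith

lemma ncard_union_real {A B : Set ℝ} {x y : ℝ} (hA : A.Finite ∧ (A.ncard : ℝ) ≤ x)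
    (hB : B.Finite ∧ (B.ncard : ℝ) ≤ y) : (A ∪ B).Finite ∧ ((A ∪ B).ncard : ℝ) ≤ x + y := by
  refine ⟨hA.1.union hB.1, ?_⟩
  have : ((A ∪ B).ncard : ℝ) ≤ A.ncard + B.ncard := by exact_mod_cast Set.ncard_union_le A B
  linarith [hA.2, hB.2]

lemma ncard_biUnion_real {ι : Type*} (s : Finset ι) (A : ι → Set ℝ) (x : ι → ℝ)
    (h : ∀ i ∈ s, (A i).Finite ∧ ((A i).ncard : ℝ) ≤ x i) :
    (⋃ i ∈ s, A i).Finite ∧ ((⋃ i ∈ s, A i).ncard : ℝ) ≤ ∑ i ∈ s, x i := by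
  classical
  induction s using Finset.induction_on with
  | empty => simp
  | insert a s ha ih =>
    rw [Finset.set_biUnion_insert, Finset.sum_insert ha]
    exact ncard_union_real (h a (Finset.mem_insert_self a s))
      (ih fun i hi => h i (Finset.mem_insert_of_mem hi))

/-- error size -/
def errSize (prime : Bool) (H : ℕ) : ℝ := if prime then 1 / (H : ℝ) else 1 / Real.sqrt H

lemma count_interval (d H : ℕ) (hH : 1 ≤ H) (prime : Bool) (a b : ℝ) (ha : 0 ≤ a) (hab : a ≤ b)
    (hb : b ≤ 1) :
    ({α : ℝ | α ∈ XSet d H prime ∧ Int.fract α ∈ Set.Icc a b}).Finite ∧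
    (({α : ℝ | α ∈ XSet d H prime ∧ Int.fract α ∈ Set.Icc a b}).ncard : ℝ) ≤
      12 * CU d * H ^ (d + 1) * ((b - a) + errSize prime H) := by
  have hH' : (1 : ℝ) ≤ H := by exact_mod_cast hH
  have hHpos : (0 : ℝ) < H := by linarith
  have hK : 0 ≤ CU d * (H : ℝ) ^ (d + 1) := mul_nonneg (CU_nonneg d) (by positivity)
  set K := CU d * (H : ℝ) ^ (d + 1) with hKdef
  have hL : 0 ≤ b - a := by linarith
  have mono : ∀ (S T : Set ℝ) (x y : ℝ), S ⊆ T → (T.Finite ∧ (T.ncard : ℝ) ≤ x) → x ≤ y →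
      S.Finite ∧ (S.ncard : ℝ) ≤ y := by
    intro S T x y hST hT hxy
    refine ⟨hT.1.subset hST, ?_⟩
    have : (S.ncard : ℝ) ≤ T.ncard := by exact_mod_cast Set.ncard_le_ncard hST hT.1
    linarith [hT.2]
  cases prime with
  | true =>
    have e1 := rootSet_Icc d H hH a b (by linarith) hb hab
    have e2 := rootSet_Icc d H hH 1 1 (by norm_num) le_rfl le_rfl
    refine mono _ _ _ _ ?_ (ncard_union_real e1 e2) ?_
    · rintro α ⟨hα, hf⟩
      simp only [XSet, if_true] at hα
      have hr := algSet_subset d H hα.1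
      rcases lt_or_eq_of_le hα.2.2 with h | h
      · left
        rw [Int.fract_eq_self.2 ⟨hα.2.1, h⟩] at hf
        exact ⟨hr, hf⟩
      · right
        exact ⟨hr, by rw [h]; simp⟩
    · simp only [errSize, if_true]
      have h0 : 0 ≤ 1 / (H : ℝ) := by positivity
      nlinarith [mul_nonneg hK h0, mul_nonneg hK hL]
  | false =>
    set N := Nat.sqrt H with hNdef
    have hN1 : 1 ≤ N := Nat.le_sqrt.2 (by simpa using hH)
    have hN1' : (1 : ℝ) ≤ N := by exact_mod_cast hN1
    have e1 := rootSet_Icc d H hH a b (by linarith) hb hab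
    have e2 := rootSet_Icc d H hH (a - 1) (b - 1) (by linarith) (by linarith) (by linarith)
    have e3 := ncard_biUnion_real (Finset.Icc 1 N)
      (fun m : ℕ => rootSet d H ∩ Set.Icc ((m : ℝ) + a) (m + b))
      (fun m : ℕ => K * ((b - a) * (1 / (m : ℝ) ^ 2) + 1 / H)) (by
        intro m hm
        have hm1 : (1 : ℝ) ≤ m := by exact_mod_cast (Finset.mem_Icc.1 hm).1
        have := rootSet_pos d H hH (m + a) (m + b) m hm1 (by linarith) (by linarith)
        have e : (m + b - (m + a)) / (m : ℝ) ^ 2 = (b - a) * (1 / (m : ℝ) ^ 2) := by ring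
        rw [e] at this
        exact this)
    have e4 := ncard_biUnion_real (Finset.Icc 1 N)
      (fun m : ℕ => rootSet d H ∩ Set.Icc (a - 1 - (m : ℝ)) (b - 1 - m))
      (fun m : ℕ => K * ((b - a) * (1 / (m : ℝ) ^ 2) + 1 / H)) (by
        intro m hm
        have hm1 : (1 : ℝ) ≤ m := by exact_mod_cast (Finset.mem_Icc.1 hm).1
        have := rootSet_neg d H hH (a - 1 - m) (b - 1 - m) m hm1 (by linarith) (by linarith)
        have e : (b - 1 - m - (a - 1 - m)) / (m : ℝ) ^ 2 = (b - a) * (1 / (m : ℝ) ^ 2) := by ring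
        rw [e] at this
        exact this)
    obtain ⟨e5, e6⟩ := rootSet_tail d H hH N hN1
    refine mono _ _ _ _ ?_ (ncard_union_real (ncard_union_real (ncard_union_real e1 e2)
      (ncard_union_real e3 e4)) (ncard_union_real e5 e6)) ?_
    · rintro α ⟨hα, hf⟩
      simp only [XSet, Bool.false_eq_true, if_false] at hα
      have hr := algSet_subset d H hα
      have hfl : (⌊α⌋ : ℝ) + Int.fract α = α := Int.floor_add_fract α
      have hf0 := Int.fract_nonneg α
      have hf1 := Int.fract_lt_one α
      obtain ⟨hfa, hfb⟩ := hf
      rcases lt_or_ge ⌊α⌋ (-1) with h | h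
      · obtain ⟨m, hm⟩ : ∃ m : ℕ, ⌊α⌋ = -1 - (m : ℤ) := ⟨(-1 - ⌊α⌋).toNat, by omega⟩
        have hm' : (⌊α⌋ : ℝ) = -1 - m := by rw [hm]; push_cast; ring
        by_cases hmN : m ≤ N
        · left; right; right
          simp only [Set.mem_iUnion]
          refine ⟨m, Finset.mem_Icc.2 ⟨by omega, hmN⟩, hr, ?_, ?_⟩ <;> linarith
        · right; right
          refine ⟨hr, ?_⟩
          have : (N : ℝ) ≤ m := by exact_mod_cast (by omega : N ≤ m)
          rw [Set.mem_Iic]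
          linarith
      · rcases eq_or_lt_of_le h with h | h
        · left; left; right
          have hm' : (⌊α⌋ : ℝ) = -1 := by rw [← h]; norm_num
          refine ⟨hr, ?_, ?_⟩ <;> linarith
        · obtain ⟨m, hm⟩ : ∃ m : ℕ, ⌊α⌋ = (m : ℤ) := ⟨⌊α⌋.toNat, by omega⟩
          have hm' : (⌊α⌋ : ℝ) = m := by rw [hm]; push_cast; ring
          by_cases hm0 : m = 0
          · left; left; left
            rw [hm0] at hm'
            push_cast at hm'
            refine ⟨hr, ?_, ?_⟩ <;> linarith
          · by_cases hmN : m ≤ N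
            · left; right; left
              simp only [Set.mem_iUnion]
              refine ⟨m, Finset.mem_Icc.2 ⟨by omega, hmN⟩, hr, ?_, ?_⟩ <;> linarith
            · right; left
              refine ⟨hr, ?_⟩
              have : (N : ℝ) ≤ m := by exact_mod_cast (by omega : N ≤ m)
              rw [Set.mem_Ici]
              linarith
    · have hsum : ∑ m ∈ Finset.Icc 1 N, K * ((b - a) * (1 / (m : ℝ) ^ 2) + 1 / H)
          ≤ K * ((b - a) * 2 + N * (1 / H)) := by
        rw [← Finset.mul_sum, Finset.sum_add_distrib, ← Finset.mul_sum]
        refine mul_le_mul_of_nonneg_left ?_ hK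
        have := mul_le_mul_of_nonneg_left (sum_inv_sq N) hL
        simp only [Finset.sum_const, Nat.card_Icc, Nat.add_sub_cancel, nsmul_eq_mul]
        linarith
      set r := Real.sqrt H with hr
      have hr1 : 1 ≤ r := Real.one_le_sqrt.2 hH'
      have hr0 : 0 < r := by linarith
      have hrr : r * r = H := Real.mul_self_sqrt hHpos.le
      have hNr : (N : ℝ) ≤ r := Real.nat_sqrt_le_real_sqrt
      have hNr2 : r ≤ N + 1 := Real.real_sqrt_le_nat_sqrt_succ
      have t1 : 1 / (H : ℝ) ≤ 1 / r := one_div_le_one_div_of_le hr0 (by nlinarith)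
      have t2 : (N : ℝ) * (1 / H) ≤ 1 / r := by
        rw [← hrr, mul_one_div, div_le_div_iff₀ (by positivity) hr0]
        nlinarith
      have t3 : 1 / (N : ℝ) ≤ 2 / r := by
        rw [div_le_div_iff₀ (by linarith) hr0]
        linarith
      have t4 : 2 / r = 2 * (1 / r) := by ring
      simp only [errSize, Bool.false_eq_true, if_false]
      rw [t4] at t3
      have u1 := mul_le_mul_of_nonneg_left t1 hK
      have u2 := mul_le_mul_of_nonneg_left t2 hK
      have u3 := mul_le_mul_of_nonneg_left t3 hK
      have u4 := mul_nonneg hK hL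
      have u5 : 0 ≤ K * (1 / r) := mul_nonneg hK (by positivity)
      have e7 : b - 1 - (a - 1) = b - a := by ring
      rw [e7]
      refine (add_le_add (add_le_add le_rfl (add_le_add hsum hsum)) le_rfl).trans ?_
      have hrhs : 12 * CU d * (H : ℝ) ^ (d + 1) * (b - a + 1 / r)
        = 12 * (K * (b - a)) + 12 * (K * (1 / r)) := by rw [hKdef]; ring
      rw [hrhs]
      simp only [mul_add] at *
      linarith
/-- Eisenstein-type coefficient vectors with a sign change on `[0,1]` -/
def cf {d : ℕ} (N : ℕ) (t : Fin (d + 1) → ℕ) : Fin (d + 1) → ℤ := fun i =>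
  if i = 0 then -(4 * (t i : ℤ) + 2) else
    if i = Fin.last d then 4 * N + 2 * (t i : ℤ) + 1 else 2 * (t i : ℤ)

lemma cf_inj {d : ℕ} (N : ℕ) : Function.Injective (cf (d := d) N) := by
  intro t t' h
  funext i
  have := congrFun h i
  unfold cf at this
  split_ifs at this <;> omega

lemma cf_zero {d : ℕ} (N : ℕ) (t : Fin (d + 1) → ℕ) : cf N t 0 = -(4 * (t 0 : ℤ) + 2) := by
  simp [cf]

lemma cf_last {d : ℕ} (hd : 2 ≤ d) (N : ℕ) (t : Fin (d + 1) → ℕ) :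
    cf N t (Fin.last d) = 4 * N + 2 * (t (Fin.last d) : ℤ) + 1 := by
  have : Fin.last d ≠ 0 := by
    intro h
    have := congrArg Fin.val h
    simp at this
    omega
  simp [cf, this]

lemma cf_even {d : ℕ} (N : ℕ) (t : Fin (d + 1) → ℕ) (i : Fin (d + 1)) (hi : i ≠ Fin.last d) :
    (2 : ℤ) ∣ cf N t i := by
  unfold cf
  split_ifs
  · exact ⟨-(2 * (t i : ℤ) + 1), by ring⟩
  · exact ⟨_, rfl⟩

lemma cf_nonneg {d : ℕ} (N : ℕ) (t : Fin (d + 1) → ℕ) (i : Fin (d + 1)) (hi : i ≠ 0) :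
    0 ≤ cf N t i := by
  unfold cf
  rw [if_neg hi]
  split_ifs <;> positivity

lemma cf_abs {d : ℕ} (N H : ℕ) (hNH : 8 * N ≤ H) (t : Fin (d + 1) → ℕ) (ht : ∀ i, t i < N)
    (i : Fin (d + 1)) : |cf N t i| ≤ (H : ℤ) := by
  have := ht i
  unfold cf
  rw [abs_le]
  split_ifs <;> omega

lemma cf_natDegree {d : ℕ} (hd : 2 ≤ d) (N : ℕ) (t : Fin (d + 1) → ℕ) :
    (polyOf (cf N t)).natDegree = d := by
  refine le_antisymm (polyOf_natDegree_le _) (Polynomial.le_natDegree_of_ne_zero ?_)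
  have := polyOf_coeff (cf N t) (Fin.last d)
  rw [Fin.val_last] at this
  rw [this, cf_last hd]
  positivity

lemma cf_lead {d : ℕ} (hd : 2 ≤ d) (N : ℕ) (t : Fin (d + 1) → ℕ) :
    (polyOf (cf N t)).leadingCoeff = 4 * N + 2 * (t (Fin.last d) : ℤ) + 1 := by
  have := polyOf_coeff (cf N t) (Fin.last d)
  rw [Fin.val_last] at this
  rw [Polynomial.leadingCoeff, cf_natDegree hd, this, cf_last hd]

lemma cf_ne_zero {d : ℕ} (hd : 2 ≤ d) (N : ℕ) (t : Fin (d + 1) → ℕ) :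
    polyOf (cf N t) ≠ 0 := by
  intro h
  have := cf_natDegree hd N t
  rw [h] at this
  simp at this
  omega

lemma cf_root {d : ℕ} (hd : 2 ≤ d) (N : ℕ) (t : Fin (d + 1) → ℕ) (ht : ∀ i, t i < N) :
    ∃ α ∈ Set.Icc (0 : ℝ) 1, Polynomial.aeval α (polyOf (cf N t)) = 0 := by
  have hcont : ContinuousOn (fun x : ℝ => Polynomial.aeval x (polyOf (cf N t))) (Set.Icc 0 1) :=
    (Polynomial.continuous_aeval _).continuousOn
  have h := intermediate_value_Icc (zero_le_one' ℝ) hcont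
  have h0 : Polynomial.aeval (0 : ℝ) (polyOf (cf N t)) ≤ 0 := by
    rw [polyOf_aeval, Fin.sum_univ_succ]
    simp only [Fin.val_zero, pow_zero, mul_one, Fin.val_succ, cf_zero]
    have : ∀ i : Fin d, (0 : ℝ) ^ ((i : ℕ) + 1) = 0 := fun i => zero_pow (by omega)
    simp only [this, mul_zero, Finset.sum_const_zero, add_zero]
    push_cast
    have : (0 : ℝ) ≤ t 0 := Nat.cast_nonneg _
    linarith
  have h1 : 0 ≤ Polynomial.aeval (1 : ℝ) (polyOf (cf N t)) := by
    rw [polyOf_aeval]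
    simp only [one_pow, mul_one]
    rw [← Int.cast_sum]
    apply Int.cast_nonneg
    rw [Fin.sum_univ_succ, cf_zero]
    obtain ⟨e, rfl⟩ : ∃ e, d = e + 1 := ⟨d - 1, by omega⟩
    have hs : cf N t (Fin.last e).succ ≤ ∑ i : Fin (e + 1), cf N t i.succ :=
      Finset.single_le_sum (f := fun i : Fin (e + 1) => cf N t i.succ)
        (fun i _ => cf_nonneg N t _ (Fin.succ_ne_zero i)) (Finset.mem_univ _)
    rw [Fin.succ_last, cf_last hd] at hs
    have := ht 0
    omega
  obtain ⟨α, hα, hα0⟩ := h ⟨h0, h1⟩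
  exact ⟨α, hα, hα0⟩

lemma cf_content_odd {d : ℕ} (hd : 2 ≤ d) (N : ℕ) (t : Fin (d + 1) → ℕ) :
    ¬ (2 : ℤ) ∣ (polyOf (cf N t)).content := by
  intro h
  have h2 := h.trans (Polynomial.content_dvd_coeff (p := polyOf (cf N t))
    (polyOf (cf N t)).natDegree)
  rw [Polynomial.coeff_natDegree, cf_lead hd] at h2
  omega

lemma cf_content_pos {d : ℕ} (hd : 2 ≤ d) (N : ℕ) (t : Fin (d + 1) → ℕ) :
    0 < (polyOf (cf N t)).content := by
  have h1 : (polyOf (cf N t)).content ≠ 0 := by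
    rw [Ne, Polynomial.content_eq_zero_iff]
    exact cf_ne_zero hd N t
  have h2 : normalize (polyOf (cf N t)).content = (polyOf (cf N t)).content :=
    Polynomial.normalize_content
  rw [← Int.abs_eq_normalize] at h2
  have := abs_nonneg (polyOf (cf N t)).content
  omega

lemma cf_coeff_eq {d : ℕ} (N : ℕ) (t : Fin (d + 1) → ℕ) (k : ℕ) :
    (polyOf (cf N t)).coeff k =
      (polyOf (cf N t)).content * (polyOf (cf N t)).primPart.coeff k := by
  conv_lhs => rw [Polynomial.eq_C_content_mul_primPart (polyOf (cf N t))]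
  rw [Polynomial.coeff_C_mul]

lemma cf_irr {d : ℕ} (hd : 2 ≤ d) (N : ℕ) (t : Fin (d + 1) → ℕ) :
    Irreducible (polyOf (cf N t)).primPart := by
  have hp2 : Prime (2 : ℤ) := Int.prime_two
  have hodd := cf_content_odd hd N t
  have hdeg : (polyOf (cf N t)).primPart.natDegree = d := by
    rw [Polynomial.natDegree_primPart, cf_natDegree hd]
  refine Polynomial.irreducible_of_eisenstein_criterion (P := Ideal.span {(2 : ℤ)})
    ((Ideal.span_singleton_prime (by norm_num)).2 hp2) ?_ ?_ ?_ ?_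
    (Polynomial.isPrimitive_primPart _)
  · rw [Ideal.mem_span_singleton]
    intro h
    have h2 := cf_coeff_eq N t d
    rw [Polynomial.leadingCoeff, hdeg] at h
    have h3 := polyOf_coeff (cf N t) (Fin.last d)
    rw [Fin.val_last, cf_last hd] at h3
    have h4 : (2 : ℤ) ∣ (polyOf (cf N t)).coeff d := by rw [h2]; exact h.mul_left _
    rw [h3] at h4
    omega
  · intro k hk
    rw [Ideal.mem_span_singleton]
    have hk' : k < d := by
      have := Polynomial.coe_lt_degree.1 hk
      omega
    have h2 := cf_coeff_eq N t k
    have h3 := polyOf_coeff (cf N t) ⟨k, by omega⟩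
    have h4 := cf_even N t ⟨k, by omega⟩ (by
      intro h
      have := congrArg Fin.val h
      simp at this
      omega)
    rw [← h3] at h4
    simp only at h4
    rw [h2] at h4
    exact (hp2.dvd_or_dvd h4).resolve_left hodd
  · apply Polynomial.natDegree_pos_iff_degree_pos.1
    omega
  · rw [Ideal.span_singleton_pow, Ideal.mem_span_singleton]
    intro h
    have h2 := cf_coeff_eq N t 0
    have h3 := polyOf_coeff (cf N t) 0
    rw [Fin.val_zero, cf_zero] at h3
    have h4 : (2 : ℤ) ^ 2 ∣ (polyOf (cf N t)).coeff 0 := by rw [h2]; exact h.mul_left _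
    rw [h3] at h4
    omega

lemma cf_prim_root {d : ℕ} (hd : 2 ≤ d) (N : ℕ) (t : Fin (d + 1) → ℕ) (α : ℝ)
    (h : Polynomial.aeval α (polyOf (cf N t)) = 0) :
    Polynomial.aeval α (polyOf (cf N t)).primPart = 0 := by
  rw [Polynomial.eq_C_content_mul_primPart (polyOf (cf N t))] at h
  rw [map_mul, Polynomial.aeval_C] at h
  rcases mul_eq_zero.1 h with h | h
  · have := (cf_content_pos hd N t).ne'
    simp at h
    exact absurd h this
  · exact h

lemma cf_mem {d : ℕ} (hd : 2 ≤ d) (N H : ℕ) (hNH : 8 * N ≤ H) (t : Fin (d + 1) → ℕ)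
    (ht : ∀ i, t i < N) (α : ℝ)
    (h : Polynomial.aeval α (polyOf (cf N t)) = 0) : α ∈ algSet d H := by
  refine ⟨(polyOf (cf N t)).primPart, cf_irr hd N t, ?_, ?_, cf_prim_root hd N t α h⟩
  · rw [Polynomial.natDegree_primPart, cf_natDegree hd]
  · intro k
    have h1 : |(polyOf (cf N t)).coeff k| ≤ (H : ℤ) := by
      by_cases hk : k < d + 1
      · have := polyOf_coeff (cf N t) ⟨k, hk⟩
        simp only at this
        rw [this]
        exact cf_abs N H hNH t ht _
      · rw [polyOf_coeff_gt _ k (by omega)]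
        simp
    rw [cf_coeff_eq, abs_mul] at h1
    have h2 := cf_content_pos hd N t
    have h3 : 1 ≤ |(polyOf (cf N t)).content| := by rw [abs_of_pos h2]; omega
    have h4 : |(polyOf (cf N t)).primPart.coeff k| ≤ (H : ℤ) := by
      nlinarith [abs_nonneg ((polyOf (cf N t)).primPart.coeff k)]
    exact_mod_cast h4

lemma irr_dvd {P Q : Polynomial ℤ} (hP : Irreducible P) (hQ : Irreducible Q)
    (hP' : P.IsPrimitive) (hQ' : Q.IsPrimitive) (α : ℝ)
    (h1 : Polynomial.aeval α P = 0) (h2 : Polynomial.aeval α Q = 0) : P ∣ Q := by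
  rw [Polynomial.IsPrimitive.Int.dvd_iff_map_cast_dvd_map_cast P Q hP']
  have i1 := (Polynomial.IsPrimitive.Int.irreducible_iff_irreducible_map_cast hP').1 hP
  have a1 : Polynomial.aeval α (P.map (Int.castRingHom ℚ)) = 0 := by
    rw [← h1]
    exact Polynomial.aeval_map_algebraMap (A := ℚ) α P
  have a2 : Polynomial.aeval α (Q.map (Int.castRingHom ℚ)) = 0 := by
    rw [← h2]
    exact Polynomial.aeval_map_algebraMap (A := ℚ) α Q
  have m1 := minpoly.eq_of_irreducible i1 a1
  have m2 := minpoly.dvd ℚ α a2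
  rw [← m1] at m2
  exact (Dvd.intro _ rfl).trans m2

lemma cf_determined {d : ℕ} (hd : 2 ≤ d) (N : ℕ) (t t' : Fin (d + 1) → ℕ) (α : ℝ)
    (h : Polynomial.aeval α (polyOf (cf N t)) = 0)
    (h' : Polynomial.aeval α (polyOf (cf N t')) = 0)
    (hc : (polyOf (cf N t)).content = (polyOf (cf N t')).content) : t = t' := by
  have r1 := cf_prim_root hd N t α h
  have r2 := cf_prim_root hd N t' α h'
  have d1 := irr_dvd (cf_irr hd N t) (cf_irr hd N t') (Polynomial.isPrimitive_primPart _)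
    (Polynomial.isPrimitive_primPart _) α r1 r2
  have d2 := irr_dvd (cf_irr hd N t') (cf_irr hd N t) (Polynomial.isPrimitive_primPart _)
    (Polynomial.isPrimitive_primPart _) α r2 r1
  obtain ⟨u, hu⟩ := associated_of_dvd_dvd d1 d2
  obtain ⟨r, hr, hru⟩ := Polynomial.isUnit_iff.1 u.isUnit
  have hP : polyOf (cf N t') = polyOf (cf N t) * Polynomial.C r := by
    rw [Polynomial.eq_C_content_mul_primPart (polyOf (cf N t')),
      Polynomial.eq_C_content_mul_primPart (polyOf (cf N t)), ← hc, ← hu, ← hru, mul_assoc]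
  have hl := cf_lead hd N t'
  rw [hP, Polynomial.leadingCoeff_mul, Polynomial.leadingCoeff_C, cf_lead hd N t] at hl
  have hr1 : r = 1 := by
    rcases Int.isUnit_iff.1 hr with h | h
    · exact h
    · exfalso
      rw [h] at hl
      omega
  rw [hr1, Polynomial.C_1, mul_one] at hP
  apply cf_inj N
  funext i
  rw [← polyOf_coeff (cf N t) i, ← polyOf_coeff (cf N t') i, hP]

/-- parameter box -/
def tBox (d N : ℕ) : Finset (Fin (d + 1) → ℕ) := Fintype.piFinset fun _ => Finset.range N

lemma mem_tBox {d N : ℕ} {t : Fin (d + 1) → ℕ} : t ∈ tBox d N ↔ ∀ i, t i < N := by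
  simp [tBox]

lemma card_tBox (d N : ℕ) : (tBox d N).card = N ^ (d + 1) := by
  simp [tBox]

lemma card_content (d N H g : ℕ) (hg : 1 ≤ g) (hNH : 8 * N ≤ H) :
    ((tBox d N).filter fun t => (polyOf (cf N t)).content = g).card ≤
      (2 * (H / g) + 1) ^ (d + 1) := by
  rw [← card_coefBox]
  have hdiv : ∀ t ∈ (tBox d N).filter fun t => (polyOf (cf N t)).content = g,
      ∀ i, (g : ℤ) ∣ cf N t i := by
    intro t ht i
    rw [← (Finset.mem_filter.1 ht).2, ← polyOf_coeff (cf N t) i]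
    exact Polynomial.content_dvd_coeff _
  refine Finset.card_le_card_of_injOn (fun t i => cf N t i / (g : ℤ)) ?_ ?_
  · intro t ht
    have ht' := mem_tBox.1 (Finset.mem_filter.1 ht).1
    refine mem_coefBox.2 fun i => ?_
    obtain ⟨k, hk⟩ := hdiv t ht i
    have h1 := cf_abs N H hNH t ht' i
    have hg0 : (g : ℤ) ≠ 0 := by positivity
    simp only
    rw [hk, Int.mul_ediv_cancel_left _ hg0]
    rw [hk, abs_mul, Nat.abs_cast] at h1
    push_cast
    rw [Int.le_ediv_iff_mul_le (by positivity)]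
    linarith
  · intro t ht t' ht' h
    apply cf_inj N
    funext i
    have h1 := congrFun h i
    simp only at h1
    rw [← Int.ediv_mul_cancel (hdiv t ht i), ← Int.ediv_mul_cancel (hdiv t' ht' i), h1]

lemma sum_tail (C n : ℕ) (hC : 1 ≤ C) :
    ∑ g ∈ Finset.Ioc C n, (1 : ℝ) / (g : ℝ) ^ 2 ≤ 1 / C := by
  have key : ∀ k : ℕ, ∑ g ∈ Finset.Ioc C (C + k), (1 : ℝ) / (g : ℝ) ^ 2 ≤ 1 / C - 1 / (C + k) := by
    intro k
    have hC' : (1 : ℝ) ≤ C := by exact_mod_cast hC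
    induction k with
    | zero => simp
    | succ k ih =>
      rw [← add_assoc, Finset.sum_Ioc_succ_top (by omega)]
      push_cast
      have hk : (0 : ℝ) ≤ k := Nat.cast_nonneg k
      set x : ℝ := C + k with hx
      have hx1 : 1 ≤ x := by linarith
      have e : 1 / x - 1 / (x + 1) - 1 / (x + 1) ^ 2 = 1 / (x * (x + 1) ^ 2) := by
        have : x ≠ 0 := by positivity
        have : x + 1 ≠ 0 := by positivity
        field_simp
        ring
      have : 0 ≤ 1 / (x * (x + 1) ^ 2) := by positivity
      have e2 : (C : ℝ) + (k + 1) = x + 1 := by rw [hx]; ring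
      rw [e2]
      linarith
  rcases le_total n C with h | h
  · rw [Finset.Ioc_eq_empty (by omega)]
    simp
  · obtain ⟨k, rfl⟩ := Nat.exists_eq_add_of_le h
    have := key k
    have h2 : (0 : ℝ) ≤ 1 / (C + k) := by positivity
    linarith

lemma lower_bound (d : ℕ) (hd : 2 ≤ d) : ∃ c : ℝ, 0 < c ∧ ∀ H : ℕ, 8 ≤ H →
    c * H ^ (d + 1) ≤ ((algSet d H ∩ Set.Icc 0 1).ncard : ℝ) := by
  classical
  set C : ℕ := 2 * 48 ^ (d + 1) with hC
  have hC1 : 1 ≤ C := by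
    have : 1 ≤ 48 ^ (d + 1) := Nat.one_le_pow _ _ (by norm_num)
    omega
  have hC0 : (0 : ℝ) < C := by exact_mod_cast hC1
  refine ⟨1 / (2 * 16 ^ (d + 1) * C), by positivity, ?_⟩
  intro H hH
  set N := H / 8 with hN
  have hNH : 8 * N ≤ H := by omega
  have hNH2 : H ≤ 16 * N := by omega
  have hHpos : (0 : ℝ) < H := by exact_mod_cast (by omega : 0 < H)
  have hfin : (algSet d H ∩ Set.Icc (0 : ℝ) 1).Finite :=
    (rootSet_Icc d H (by omega) 0 1 (by norm_num) le_rfl zero_le_one).1.subset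
      (Set.inter_subset_inter_left _ (algSet_subset d H))
  -- the part with large content
  set big := (tBox d N).filter fun t => (C : ℤ) < (polyOf (cf N t)).content with hbig
  set small := (tBox d N).filter fun t => ¬ (C : ℤ) < (polyOf (cf N t)).content with hsmall
  have hcard : big.card + small.card = N ^ (d + 1) := by
    rw [← card_tBox d N]
    exact Finset.card_filter_add_card_filter_not _
  have hbigsub : big ⊆ (Finset.Ioc C H).biUnion fun g =>
      (tBox d N).filter fun t => (polyOf (cf N t)).content = g := by
    intro t ht
    obtain ⟨htB, hlt⟩ := Finset.mem_filter.1 ht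
    have hpos := cf_content_pos hd N t
    refine Finset.mem_biUnion.2 ⟨(polyOf (cf N t)).content.toNat, ?_, ?_⟩
    · have hle : (polyOf (cf N t)).content ≤ H := by
        have h1 : (polyOf (cf N t)).content ∣ cf N t (Fin.last d) := by
          rw [← polyOf_coeff (cf N t)]
          exact Polynomial.content_dvd_coeff _
        have h2 := Int.le_of_dvd (by rw [cf_last hd]; positivity) h1
        have h3 := cf_abs N H hNH t (mem_tBox.1 htB) (Fin.last d)
        exact h2.trans ((le_abs_self _).trans h3)
      rw [Finset.mem_Ioc]
      omega
    · refine Finset.mem_filter.2 ⟨htB, ?_⟩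
      omega
  have hbigcard : (big.card : ℝ) ≤ (3 * H) ^ (d + 1) * (1 / C) := by
    have h1 : (big.card : ℝ) ≤ ∑ g ∈ Finset.Ioc C H, ((2 * (H / g) + 1) ^ (d + 1) : ℕ) := by
      exact_mod_cast (Finset.card_le_card hbigsub).trans (Finset.card_biUnion_le.trans
        (Finset.sum_le_sum fun g hg => card_content d N H g
          (by have := (Finset.mem_Ioc.1 hg).1; omega) hNH))
    refine h1.trans ?_
    rw [Nat.cast_sum]
    have h2 : ∀ g ∈ Finset.Ioc C H, (((2 * (H / g) + 1) ^ (d + 1) : ℕ) : ℝ) ≤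
        (3 * H) ^ (d + 1) * (1 / (g : ℝ) ^ 2) := by
      intro g hg
      obtain ⟨hg1, hg2⟩ := Finset.mem_Ioc.1 hg
      have hg1' : (1 : ℝ) ≤ g := by exact_mod_cast (by omega : 1 ≤ g)
      have hg0 : (0 : ℝ) < g := by linarith
      have hg2' : (g : ℝ) ≤ H := by exact_mod_cast hg2
      push_cast
      have h3 : ((H / g : ℕ) : ℝ) ≤ H / g := Nat.cast_div_le
      have h4 : (1 : ℝ) ≤ H / g := by rwa [le_div_iff₀ hg0, one_mul]
      calc (2 * ((H / g : ℕ) : ℝ) + 1) ^ (d + 1) ≤ (3 * H / g) ^ (d + 1) := by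
            gcongr
            rw [mul_div_assoc]
            linarith
        _ = (3 * H) ^ (d + 1) * (1 / (g : ℝ) ^ (d + 1)) := by rw [div_pow]; ring
        _ ≤ (3 * H) ^ (d + 1) * (1 / (g : ℝ) ^ 2) := by
            gcongr
            omega
    refine (Finset.sum_le_sum h2).trans ?_
    rw [← Finset.mul_sum]
    exact mul_le_mul_of_nonneg_left (sum_tail C H hC1) (by positivity)
  have hsmallcard : small.card ≤ (algSet d H ∩ Set.Icc 0 1).ncard * C := by
    rw [Set.ncard_eq_toFinset_card _ hfin]
    have : ∀ t : Fin (d + 1) → ℕ, ∃ α : ℝ, (∀ i, t i < N) → α ∈ Set.Icc (0 : ℝ) 1 ∧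
        Polynomial.aeval α (polyOf (cf N t)) = 0 := by
      intro t
      by_cases ht : ∀ i, t i < N
      · obtain ⟨α, h1, h2⟩ := cf_root hd N t ht
        exact ⟨α, fun _ => ⟨h1, h2⟩⟩
      · exact ⟨0, fun h => absurd h ht⟩
    choose α hα using this
    have hcC : C = (Finset.Icc 1 C).card := by simp
    conv_rhs => rw [hcC]
    rw [← Finset.card_product]
    refine Finset.card_le_card_of_injOn
      (fun t => (α t, (polyOf (cf N t)).content.toNat)) ?_ ?_
    · intro t ht
      obtain ⟨htB, hlt⟩ := Finset.mem_filter.1 ht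
      have htB' := mem_tBox.1 htB
      have hpos := cf_content_pos hd N t
      have h1 := hα t htB'
      rw [Finset.mem_coe, Finset.mem_product]
      refine ⟨?_, ?_⟩
      · rw [Set.Finite.mem_toFinset]
        exact ⟨cf_mem hd N H hNH t htB' _ h1.2, h1.1⟩
      · rw [Finset.mem_Icc]
        simp only
        omega
    · intro t ht t' ht' h
      have h1 := hα t (mem_tBox.1 (Finset.mem_filter.1 ht).1)
      have h2 := hα t' (mem_tBox.1 (Finset.mem_filter.1 ht').1)
      have p1 := cf_content_pos hd N t
      have p2 := cf_content_pos hd N t'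
      rw [Prod.mk.injEq] at h
      obtain ⟨ha, hb⟩ := h
      rw [← ha] at h2
      exact cf_determined hd N t t' (α t) h1.2 h2.2 (by omega)
  have hNpow : ((H : ℝ) / 16) ^ (d + 1) ≤ (N : ℝ) ^ (d + 1) := by
    gcongr
    have : (H : ℝ) ≤ 16 * N := by exact_mod_cast hNH2
    linarith
  have e1 : (3 * (H : ℝ)) ^ (d + 1) * (1 / C) = ((H : ℝ) / 16) ^ (d + 1) / 2 := by
    rw [hC]
    push_cast
    have : (48 : ℝ) ^ (d + 1) = 3 ^ (d + 1) * 16 ^ (d + 1) := by rw [← mul_pow]; norm_num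
    rw [this, mul_pow, div_pow]
    field_simp
  rw [e1] at hbigcard
  have hcard' : (big.card : ℝ) + small.card = (N : ℝ) ^ (d + 1) := by exact_mod_cast hcard
  have hsmall' : (small.card : ℝ) ≤ ((algSet d H ∩ Set.Icc 0 1).ncard : ℝ) * C := by
    exact_mod_cast hsmallcard
  have hfinal : ((H : ℝ) / 16) ^ (d + 1) / 2 ≤ ((algSet d H ∩ Set.Icc 0 1).ncard : ℝ) * C := by
    linarith
  have e2 : 1 / (2 * 16 ^ (d + 1) * (C : ℝ)) * (H : ℝ) ^ (d + 1)
      = (((H : ℝ) / 16) ^ (d + 1) / 2) / C := by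
    rw [div_pow]
    field_simp
  rw [e2, div_le_iff₀ hC0]
  exact hfinal
/-- finite unions of open order-connected sets -/
def GoodOpen (V : Set ℝ) : Prop :=
  ∃ s : Set (Set ℝ), s.Finite ∧ (∀ C ∈ s, IsOpen C ∧ C.OrdConnected) ∧ V = ⋃₀ s

lemma goodOpen_univ : GoodOpen Set.univ :=
  ⟨{Set.univ}, Set.finite_singleton _, by
    rintro C rfl
    exact ⟨isOpen_univ, Set.ordConnected_univ⟩, by simp⟩

lemma goodOpen_diff {V : Set ℝ} (h : GoodOpen V) (a b : ℝ) : GoodOpen (V \ Set.Icc a b) := by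
  obtain ⟨s, hs, hC, rfl⟩ := h
  refine ⟨(fun C => C ∩ Set.Iio a) '' s ∪ (fun C => C ∩ Set.Ioi b) '' s,
    (hs.image _).union (hs.image _), ?_, ?_⟩
  · rintro C (⟨D, hD, rfl⟩ | ⟨D, hD, rfl⟩)
    · exact ⟨(hC D hD).1.inter isOpen_Iio, (hC D hD).2.inter Set.ordConnected_Iio⟩
    · exact ⟨(hC D hD).1.inter isOpen_Ioi, (hC D hD).2.inter Set.ordConnected_Ioi⟩
  · ext x
    constructor
    · rintro ⟨⟨D, hD, hx⟩, hn⟩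
      by_cases hxa : x < a
      · exact ⟨D ∩ Set.Iio a, Or.inl ⟨D, hD, rfl⟩, hx, hxa⟩
      · refine ⟨D ∩ Set.Ioi b, Or.inr ⟨D, hD, rfl⟩, hx, ?_⟩
        by_contra hb
        exact hn ⟨not_lt.1 hxa, not_lt.1 hb⟩
    · rintro ⟨C, ⟨D, hD, rfl⟩ | ⟨D, hD, rfl⟩, hx, hxa⟩
      · exact ⟨⟨D, hD, hx⟩, fun h => not_lt.2 h.1 hxa⟩
      · exact ⟨⟨D, hD, hx⟩, fun h => not_lt.2 h.2 hxa⟩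

lemma goodOpen_biUnion {ι : Type*} (s : Finset ι) (a b : ι → ℝ) :
    GoodOpen ((⋃ i ∈ s, Set.Icc (a i) (b i))ᶜ) := by
  classical
  induction s using Finset.induction_on with
  | empty => simpa using goodOpen_univ
  | insert i s hi ih =>
    have := goodOpen_diff ih (a i) (b i)
    rw [Finset.set_biUnion_insert, Set.compl_union, Set.inter_comm]
    exact this

lemma JPsi_subset (Ψ : ℝ → ℝ) (Q₁ Q₂ : ℕ) : JPsi Ψ Q₁ Q₂ ⊆ Set.Icc 0 1 := by
  intro x hx
  simp only [JPsi, Set.mem_iUnion] at hx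
  obtain ⟨q, _, p, _, h⟩ := hx
  exact h.2

lemma diff_JPsi (Ψ : ℝ → ℝ) (Q₁ Q₂ : ℕ) :
    ∃ V : Set ℝ, GoodOpen V ∧ Set.Icc 0 1 \ JPsi Ψ Q₁ Q₂ = Set.Icc 0 1 ∩ V := by
  refine ⟨_, goodOpen_biUnion ((Finset.Ico Q₁ Q₂).sigma fun q => Finset.range (q + 1))
    (fun i => (i.2 : ℝ) / i.1 - Ψ i.1 / i.1) (fun i => (i.2 : ℝ) / i.1 + Ψ i.1 / i.1), ?_⟩
  ext x
  simp only [JPsi, Set.mem_sdiff, Set.mem_inter_iff, Set.mem_compl_iff, Set.mem_iUnion,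
    Finset.mem_sigma]
  constructor
  · rintro ⟨h1, h2⟩
    refine ⟨h1, ?_⟩
    rintro ⟨⟨q, p⟩, ⟨hq, hp⟩, h⟩
    exact h2 ⟨q, hq, p, hp, h, h1⟩
  · rintro ⟨h1, h2⟩
    refine ⟨h1, ?_⟩
    rintro ⟨q, hq, p, hp, h, _⟩
    exact h2 ⟨⟨q, p⟩, ⟨hq, hp⟩, h⟩

lemma JTilde_subset (Ψ : ℝ → ℝ) (Q₁ Q₂ : ℕ) : JTilde Ψ Q₁ Q₂ ⊆ Set.Icc 0 1 :=
  closure_minimal Set.sdiff_subset isClosed_Icc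

lemma comp_vol_ne_top {S : Set ℝ} (hS : S ⊆ Set.Icc 0 1) (x : ℝ) :
    volume (connectedComponentIn S x) ≠ ⊤ := by
  refine ne_top_of_le_ne_top ?_ (measure_mono ((connectedComponentIn_subset S x).trans hS))
  simp

lemma lenStar_pos (Ψ : ℝ → ℝ) (Q₁ Q₂ : ℕ) (hne : (Set.Icc 0 1 \ JPsi Ψ Q₁ Q₂).Nonempty) :
    0 < lenStar (JTilde Ψ Q₁ Q₂) := by
  obtain ⟨V, ⟨s, hs, hC, rfl⟩, hV⟩ := diff_JPsi Ψ Q₁ Q₂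
  set s' := {C ∈ s | (Set.Icc (0 : ℝ) 1 ∩ C).Nonempty} with hs'
  have hs'fin : s'.Finite := hs.subset (Set.sep_subset _ _)
  have hs'ne : s'.Nonempty := by
    rw [hV] at hne
    obtain ⟨x, hx, C, hCs, hxC⟩ := hne
    exact ⟨C, hCs, x, hx, hxC⟩
  set f : Set ℝ → ℝ := fun C => (volume (Set.Icc (0 : ℝ) 1 ∩ C)).toReal with hf
  have hntop : ∀ C : Set ℝ, volume (Set.Icc (0 : ℝ) 1 ∩ C) ≠ ⊤ := fun C =>
    ne_top_of_le_ne_top (by simp) (measure_mono (Set.inter_subset_left))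
  have hfpos : ∀ C ∈ s', 0 < f C := by
    rintro C ⟨hCs, x, hx, hxC⟩
    have hopen := (hC C hCs).1
    have h1 : (Set.Ioo (0 : ℝ) 1 ∩ C).Nonempty := by
      have hx' : x ∈ closure (Set.Ioo (0 : ℝ) 1) := by
        rw [closure_Ioo (by norm_num)]; exact hx
      rw [Set.inter_comm]
      exact mem_closure_iff.1 hx' C hopen hxC
    have h2 : 0 < volume (Set.Ioo (0 : ℝ) 1 ∩ C) := (isOpen_Ioo.inter hopen).measure_pos _ h1
    have h3 : 0 < volume (Set.Icc (0 : ℝ) 1 ∩ C) :=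
      lt_of_lt_of_le h2 (measure_mono (Set.inter_subset_inter_left _ Set.Ioo_subset_Icc_self))
    exact ENNReal.toReal_pos h3.ne' (hntop C)
  obtain ⟨C₀, hC₀, hmin⟩ := Set.exists_min_image s' f hs'fin hs'ne
  refine lt_of_lt_of_le (hfpos C₀ hC₀) ?_
  unfold lenStar
  have hJne : (JTilde Ψ Q₁ Q₂).Nonempty := hne.mono subset_closure
  refine le_csInf (hJne.image _) ?_
  rintro _ ⟨x, hx, rfl⟩
  have hcl : JTilde Ψ Q₁ Q₂ = ⋃ C ∈ s', closure (Set.Icc (0 : ℝ) 1 ∩ C) := by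
    rw [← hs'fin.closure_biUnion]
    unfold JTilde
    rw [hV]
    congr 1
    ext y
    simp only [Set.mem_iUnion]
    constructor
    · rintro ⟨hy, C, hCs, hyC⟩
      exact ⟨C, ⟨hCs, y, hy, hyC⟩, hy, hyC⟩
    · rintro ⟨C, ⟨hCs, _⟩, hy, hyC⟩
      exact ⟨hy, C, hCs, hyC⟩
  have hx' := hx
  rw [hcl] at hx'
  simp only [Set.mem_iUnion] at hx'
  obtain ⟨C, hCs, hxC⟩ := hx'
  refine (hmin C hCs).trans ?_
  have hpre : IsPreconnected (closure (Set.Icc (0 : ℝ) 1 ∩ C)) :=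
    ((Set.ordConnected_Icc.inter (hC C hCs.1).2).isPreconnected).closure
  have hsub : closure (Set.Icc (0 : ℝ) 1 ∩ C) ⊆ connectedComponentIn (JTilde Ψ Q₁ Q₂) x := by
    refine hpre.subset_connectedComponentIn hxC ?_
    rw [hcl]
    exact Set.subset_biUnion_of_mem (u := fun C => closure (Set.Icc (0 : ℝ) 1 ∩ C)) hCs
  exact ENNReal.toReal_mono (comp_vol_ne_top (JTilde_subset Ψ Q₁ Q₂) x)
    (measure_mono (subset_closure.trans hsub))

lemma comp_closed {S : Set ℝ} (hcl : IsClosed S) {x : ℝ} (hx : x ∈ S) :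
    IsClosed (connectedComponentIn S x) := by
  refine isClosed_of_closure_subset ?_
  exact isPreconnected_connectedComponentIn.closure.subset_connectedComponentIn
    (subset_closure (mem_connectedComponentIn hx))
    (closure_minimal (connectedComponentIn_subset S x) hcl)

lemma comp_Icc {S : Set ℝ} (hS : S ⊆ Set.Icc 0 1) (hcl : IsClosed S) {x : ℝ} (hx : x ∈ S) :
    ∃ a b : ℝ, 0 ≤ a ∧ a ≤ b ∧ b ≤ 1 ∧ connectedComponentIn S x = Set.Icc a b := by
  have h1 : IsConnected (connectedComponentIn S x) := isConnected_connectedComponentIn_iff.2 hx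
  have h2 : IsClosed (connectedComponentIn S x) := comp_closed hcl hx
  have h4 : connectedComponentIn S x ⊆ Set.Icc 0 1 := (connectedComponentIn_subset S x).trans hS
  have h3 : IsCompact (connectedComponentIn S x) := isCompact_Icc.of_isClosed_subset h2 h4
  have h5 := eq_Icc_of_connected_compact h1 h3
  set a := sInf (connectedComponentIn S x)
  set b := sSup (connectedComponentIn S x)
  have hab : a ≤ b := by
    have := h1.nonempty
    rw [h5] at this
    exact Set.nonempty_Icc.1 this
  have ha : a ∈ Set.Icc (0 : ℝ) 1 := h4 (h5 ▸ Set.left_mem_Icc.2 hab)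
  have hb : b ∈ Set.Icc (0 : ℝ) 1 := h4 (h5 ▸ Set.right_mem_Icc.2 hab)
  exact ⟨a, b, ha.1, hab, hb.2, h5⟩

/-- decomposition into finitely many components -/
lemma comp_decomp {S : Set ℝ} (hS : S ⊆ Set.Icc 0 1) (hcl : IsClosed S) (hpos : 0 < lenStar S) :
    ∃ F : Finset (Set ℝ), (∀ I ∈ F, ∃ a b : ℝ, 0 ≤ a ∧ a ≤ b ∧ b ≤ 1 ∧ I = Set.Icc a b) ∧
      S = (⋃ I ∈ F, I) ∧ ∑ I ∈ F, (volume I).toReal ≤ (volume S).toReal ∧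
      F.card * lenStar S ≤ (volume S).toReal := by
  classical
  set comps : Set (Set ℝ) := (fun x => connectedComponentIn S x) '' S with hcomps
  have hStop : volume S ≠ ⊤ := ne_top_of_le_ne_top (by simp) (measure_mono hS)
  have hlen : ∀ I ∈ comps, lenStar S ≤ (volume I).toReal := by
    rintro _ ⟨x, hx, rfl⟩
    exact csInf_le ⟨0, by rintro _ ⟨y, _, rfl⟩; exact ENNReal.toReal_nonneg⟩ ⟨x, hx, rfl⟩
  have hdisj : comps.PairwiseDisjoint id := by
    rintro _ ⟨x, hx, rfl⟩ _ ⟨y, hy, rfl⟩ hne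
    rw [Function.onFun, Set.disjoint_left]
    intro z hz1 hz2
    apply hne
    exact (connectedComponentIn_eq hz1).trans (connectedComponentIn_eq hz2).symm
  have hsub : ∀ I ∈ comps, I ⊆ S := by
    rintro _ ⟨x, hx, rfl⟩
    exact connectedComponentIn_subset S x
  have hmeas : ∀ I ∈ comps, MeasurableSet I := by
    rintro _ ⟨x, hx, rfl⟩
    exact (comp_closed hcl hx).measurableSet
  have hsum : ∀ F : Finset (Set ℝ), (F : Set (Set ℝ)) ⊆ comps →
      ∑ I ∈ F, (volume I).toReal ≤ (volume S).toReal := by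
    intro F hF
    rw [← ENNReal.toReal_sum (fun I hI => ne_top_of_le_ne_top hStop (measure_mono (hsub I (hF hI))))]
    have : volume (⋃ I ∈ F, id I) = ∑ I ∈ F, volume (id I) :=
      measure_biUnion_finset (hdisj.subset hF) (fun I hI => hmeas I (hF hI))
    simp only [id] at this
    rw [← this]
    exact ENNReal.toReal_mono hStop (measure_mono (Set.iUnion₂_subset fun I hI => hsub I (hF hI)))
  have hcardF : ∀ F : Finset (Set ℝ), (F : Set (Set ℝ)) ⊆ comps →
      F.card * lenStar S ≤ (volume S).toReal := by
    intro F hF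
    refine le_trans ?_ (hsum F hF)
    rw [← nsmul_eq_mul]
    exact Finset.card_nsmul_le_sum _ _ _ fun I hI => hlen I (hF hI)
  have hfin : comps.Finite := by
    by_contra hinf
    obtain ⟨n, hn⟩ := exists_nat_gt ((volume S).toReal / lenStar S)
    obtain ⟨F, hF, hFn⟩ := (Set.not_finite.1 hinf : comps.Infinite).exists_subset_card_eq n
    have := hcardF F hF
    rw [hFn] at this
    rw [div_lt_iff₀ hpos] at hn
    linarith
  refine ⟨hfin.toFinset, ?_, ?_, hsum _ (by simp), hcardF _ (by simp)⟩
  · intro I hI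
    obtain ⟨x, hx, rfl⟩ := (hfin.mem_toFinset).1 hI
    exact comp_Icc hS hcl hx
  · apply Set.Subset.antisymm
    · intro x hx
      simp only [Set.mem_iUnion]
      exact ⟨connectedComponentIn S x, hfin.mem_toFinset.2 ⟨x, hx, rfl⟩,
        mem_connectedComponentIn hx⟩
    · exact Set.iUnion₂_subset fun I hI => hsub I (hfin.mem_toFinset.1 hI)

lemma fract_mem (α : ℝ) : Int.fract α ∈ Set.Icc (0 : ℝ) 1 :=
  ⟨Int.fract_nonneg α, (Int.fract_lt_one α).le⟩

lemma XSet_finite (d H : ℕ) (hH : 1 ≤ H) (prime : Bool) : (XSet d H prime).Finite := by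
  refine (count_interval d H hH prime 0 1 le_rfl zero_le_one le_rfl).1.subset ?_
  intro α hα
  exact ⟨hα, fract_mem α⟩

lemma errSize_le (d H : ℕ) (hH : 2 ≤ H) (prime : Bool) : errSize prime H ≤ ErrTerm prime 2 d H := by
  have hH' : (2 : ℝ) ≤ H := by exact_mod_cast hH
  have hlog : (1 / 2 : ℝ) ≤ Real.log H ^ lfun d := by
    unfold lfun
    split_ifs
    · rw [pow_one]
      have h1 := Real.log_two_gt_d9
      have h2 : Real.log 2 ≤ Real.log H := Real.log_le_log (by norm_num) hH'
      linarith
    · norm_num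
  cases prime with
  | true =>
    simp only [errSize, ErrTerm, if_true]
    gcongr
    linarith
  | false =>
    simp only [errSize, ErrTerm, Bool.false_eq_true, if_false]
    have h1 : Real.sqrt (1 / 4 / H) ≤ Real.sqrt (Real.log H ^ lfun d / H) := by
      apply Real.sqrt_le_sqrt
      gcongr
      linarith
    have h2 : Real.sqrt (1 / 4 / H) = 1 / 2 / Real.sqrt H := by
      rw [Real.sqrt_div (by norm_num)]
      congr 1
      rw [show (1 / 4 : ℝ) = (1 / 2) ^ 2 by norm_num, Real.sqrt_sq (by norm_num)]
    rw [h2] at h1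
    have e : 1 / Real.sqrt H = 2 * (1 / 2 / Real.sqrt H) := by ring
    rw [e]
    linarith
theorem stmt1 (d : ℕ) (hd : 2 ≤ d) (prime : Bool) :
    (∀ Ψ : ℝ → ℝ, IsApproxFun Ψ → ∀ Q₁ Q₂ : ℕ, 1 ≤ Q₁ → Q₁ < Q₂ →
      lenStar (JTilde Ψ Q₁ Q₂) = 0 →
        JPsi Ψ Q₁ Q₂ = Set.Icc 0 1 ∧
        ∀ H : ℕ, 1 ≤ H → (XSet d H prime).Nonempty →
          (countModOne (XSet d H prime) (JPsi Ψ Q₁ Q₂) : ℝ) /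
            (Set.ncard (XSet d H prime) : ℝ) = 1) ∧
    (∃ (H₀ : ℕ) (Cerr C₁ C₂ : ℝ), 2 ≤ H₀ ∧ 0 < Cerr ∧ 0 < C₁ ∧ 0 < C₂ ∧
      ∀ Ψ : ℝ → ℝ, IsApproxFun Ψ →
      ∀ Q₁ Q₂ : ℕ, 1 ≤ Q₁ → Q₁ < Q₂ →
      ∀ δ : ℝ, δ ∈ Set.Ioo (0 : ℝ) 1 →
      ∀ H : ℕ, H₀ ≤ H →
      0 < lenStar (JTilde Ψ Q₁ Q₂) →
      lenStar (JTilde Ψ Q₁ Q₂) < C₁ * δ →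
      1 - (countModOne (XSet d H prime) (JPsi Ψ Q₁ Q₂) : ℝ) /
            (Set.ncard (XSet d H prime) : ℝ) ≤
        C₂ * (volume (JTilde Ψ Q₁ Q₂)).toReal * (1 + lenStar (JTilde Ψ Q₁ Q₂)) *
          (1 / (1 - δ) + ErrTerm prime Cerr d H / lenStar (JTilde Ψ Q₁ Q₂))) := by
  constructor
  · intro Ψ _ Q₁ Q₂ _ _ hlen
    have hJ : JPsi Ψ Q₁ Q₂ = Set.Icc 0 1 := by
      refine Set.Subset.antisymm (JPsi_subset Ψ Q₁ Q₂) ?_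
      by_contra h
      have hne : (Set.Icc 0 1 \ JPsi Ψ Q₁ Q₂).Nonempty := Set.sdiff_nonempty.2 h
      have := lenStar_pos Ψ Q₁ Q₂ hne
      linarith
    refine ⟨hJ, ?_⟩
    intro H hH hne
    have e : countModOne (XSet d H prime) (JPsi Ψ Q₁ Q₂) = (XSet d H prime).ncard := by
      unfold countModOne
      congr 1
      ext α
      rw [hJ]
      exact ⟨fun h => h.1, fun h => ⟨h, fract_mem α⟩⟩
    rw [e, div_self]
    have := (Set.ncard_pos (XSet_finite d H hH prime)).2 hne
    exact_mod_cast this.ne'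
  · obtain ⟨c, hc, hlow⟩ := lower_bound d hd
    refine ⟨8, 2, 1, 12 * CU d / c + 1, by norm_num, by norm_num, by norm_num, ?_, ?_⟩
    · have := CU_nonneg d
      positivity
    intro Ψ _ Q₁ Q₂ _ _ δ hδ H hH hpos _
    set S := JTilde Ψ Q₁ Q₂ with hSdef
    set ℓ := lenStar S with hℓ
    set X := XSet d H prime with hX
    set E := ErrTerm prime 2 d H with hE
    have hXfin : X.Finite := XSet_finite d H (by omega) prime
    have hHpos : (0 : ℝ) < H := by exact_mod_cast (by omega : 0 < H)
    have hHp : (0 : ℝ) < (H : ℝ) ^ (d + 1) := by positivity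
    have hXlow : c * (H : ℝ) ^ (d + 1) ≤ (X.ncard : ℝ) := by
      refine (hlow H hH).trans ?_
      have hsub : algSet d H ∩ Set.Icc 0 1 ⊆ X := by
        rw [hX]
        cases prime with
        | true => simp [XSet]
        | false => simp [XSet]
      exact_mod_cast Set.ncard_le_ncard hsub hXfin
    have hXpos : (0 : ℝ) < X.ncard := lt_of_lt_of_le (by positivity) hXlow
    obtain ⟨F, hF, hSF, hvol, hcard⟩ := comp_decomp (JTilde_subset Ψ Q₁ Q₂) isClosed_closure hpos
    have hE0 : errSize prime H ≤ E := errSize_le d H (by omega) prime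
    have hcount := ncard_biUnion_real F
      (fun I => {α : ℝ | α ∈ X ∧ Int.fract α ∈ I})
      (fun I => 12 * CU d * (H : ℝ) ^ (d + 1) * ((volume I).toReal + E)) (by
        intro I hI
        obtain ⟨a, b, ha, hab, hb, rfl⟩ := hF I hI
        obtain ⟨h1, h2⟩ := count_interval d H (by omega) prime a b ha hab hb
        refine ⟨h1, h2.trans ?_⟩
        rw [Real.volume_Icc, ENNReal.toReal_ofReal (by linarith)]
        have := CU_nonneg d
        gcongr)
    set bad := {α : ℝ | α ∈ X ∧ Int.fract α ∉ JPsi Ψ Q₁ Q₂} with hbad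
    have hbadsub : bad ⊆ ⋃ I ∈ F, {α : ℝ | α ∈ X ∧ Int.fract α ∈ I} := by
      rintro α ⟨hα, hn⟩
      have hm : Int.fract α ∈ S := subset_closure ⟨fract_mem α, hn⟩
      rw [hSdef, hSF] at hm
      simp only [Set.mem_iUnion] at hm ⊢
      obtain ⟨I, hI, hm⟩ := hm
      exact ⟨I, hI, hα, hm⟩
    have hbadcard : (bad.ncard : ℝ) ≤
        12 * CU d * (H : ℝ) ^ (d + 1) * ((volume S).toReal * (1 + E / ℓ)) := by
      have h1 : (bad.ncard : ℝ) ≤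
          ((⋃ I ∈ F, {α : ℝ | α ∈ X ∧ Int.fract α ∈ I}).ncard : ℝ) := by
        exact_mod_cast Set.ncard_le_ncard hbadsub hcount.1
      refine (h1.trans hcount.2).trans ?_
      rw [← Finset.mul_sum, Finset.sum_add_distrib, Finset.sum_const, nsmul_eq_mul]
      have h3 : 0 ≤ E := le_trans (by unfold errSize; split_ifs <;> positivity) hE0
      have h4 : (F.card : ℝ) * E ≤ (volume S).toReal * (E / ℓ) := by
        have h5 : (F.card : ℝ) ≤ (volume S).toReal / ℓ := by
          rw [le_div_iff₀ hpos]; exact hcard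
        calc (F.card : ℝ) * E ≤ (volume S).toReal / ℓ * E := mul_le_mul_of_nonneg_right h5 h3
          _ = (volume S).toReal * (E / ℓ) := by ring
      have h6 := CU_nonneg d
      refine mul_le_mul_of_nonneg_left ?_ (by positivity)
      rw [mul_add, mul_one]
      linarith
    have hsplit : (countModOne X (JPsi Ψ Q₁ Q₂) : ℝ) + bad.ncard = X.ncard := by
      have h1 : {α : ℝ | α ∈ X ∧ Int.fract α ∈ JPsi Ψ Q₁ Q₂} ∪ bad = X := by
        ext α
        constructor
        · rintro (h | h)
          · exact h.1
          · exact h.1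
        · intro h
          by_cases hm : Int.fract α ∈ JPsi Ψ Q₁ Q₂
          · exact Or.inl ⟨h, hm⟩
          · exact Or.inr ⟨h, hm⟩
      have h2 : Disjoint {α : ℝ | α ∈ X ∧ Int.fract α ∈ JPsi Ψ Q₁ Q₂} bad := by
        rw [Set.disjoint_left]
        rintro α h h'
        exact h'.2 h.2
      have h3 := Set.ncard_union_eq h2 (hXfin.subset fun α h => h.1) (hXfin.subset fun α h => h.1)
      rw [h1] at h3
      unfold countModOne
      exact_mod_cast h3.symm
    have hratio : 1 - (countModOne X (JPsi Ψ Q₁ Q₂) : ℝ) / (X.ncard : ℝ)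
        = bad.ncard / X.ncard := by
      field_simp
      linarith
    rw [hratio]
    have hv0 : 0 ≤ (volume S).toReal := ENNReal.toReal_nonneg
    have h3 : 0 ≤ E := le_trans (by unfold errSize; split_ifs <;> positivity) hE0
    have h6 := CU_nonneg d
    have hEl : 0 ≤ E / ℓ := div_nonneg h3 hpos.le
    calc (bad.ncard : ℝ) / X.ncard
        ≤ (12 * CU d * (H : ℝ) ^ (d + 1) * ((volume S).toReal * (1 + E / ℓ)))
            / (c * (H : ℝ) ^ (d + 1)) := by
          gcongr
      _ = 12 * CU d / c * (volume S).toReal * 1 * (1 + E / ℓ) := by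
          field_simp
      _ ≤ (12 * CU d / c + 1) * (volume S).toReal * (1 + ℓ) * (1 / (1 - δ) + E / ℓ) := by
          have hδ1 : 1 ≤ 1 / (1 - δ) := by
            rw [le_div_iff₀ (by linarith [hδ.2])]
            linarith [hδ.1]
          gcongr
          · linarith
          · linarith
end
end
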